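/- arXiv:1112.2992 — 6 statements merged into one kernel-verified Lean document; each statement's English description precedes it below -/
import Mathlib

section
/- Let Ψ : C⊗D → D⊗C be a twist map such that the twisted coproduct Δ_Ψ admits a counit e, and let p_C := (id_C⊗e)∘(Δ_C⊗id_D), p_D := (e⊗id_D)∘(id_C⊗Δ_D). Then e is invertible in the algebra ((C⊗D)', ⋆) if and only if the linear map μ := (p_C⊗p_D)∘Δ_Ψ : C⊗D → C⊗D, given explicitly by μ(c⊗d) = e(c₍₂₎⊗d₍₁₎) c₍₁₎⊗d₍₂₎, is bijective. -/
open TensorProduct LinearMap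

noncomputable section
namespace TwistedTensor

/-- The coproduct of a coalgebra, with explicit arguments. -/
def cmul (k C : Type*) [CommSemiring k] [AddCommMonoid C] [Module k C] [Coalgebra k C] :
    C →ₗ[k] C ⊗[k] C := Coalgebra.comul

/-- The counit of a coalgebra, with explicit arguments. -/
def eps (k C : Type*) [CommSemiring k] [AddCommMonoid C] [Module k C] [Coalgebra k C] :
    C →ₗ[k] k := Coalgebra.counit

variable {k : Type*} [Field k]
variable {C D : Type*} [AddCommGroup C] [Module k C] [AddCommGroup D] [Module k D]
  [Coalgebra k C] [Coalgebra k D]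

/-- The twisted coproduct `Δ_Ψ := (id_C ⊗ Ψ ⊗ id_D) ∘ (Δ_C ⊗ Δ_D)` (with the
appropriate reassociations of tensor factors). -/
def twistedComul (Ψ : C ⊗[k] D →ₗ[k] D ⊗[k] C) :
    C ⊗[k] D →ₗ[k] (C ⊗[k] D) ⊗[k] (C ⊗[k] D) :=
  (TensorProduct.assoc k C D (C ⊗[k] D)).symm.toLinearMap
    ∘ₗ lTensor C (TensorProduct.assoc k D C D).toLinearMap
    ∘ₗ lTensor C (rTensor D Ψ)
    ∘ₗ lTensor C (TensorProduct.assoc k C D D).symm.toLinearMap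
    ∘ₗ (TensorProduct.assoc k C C (D ⊗[k] D)).toLinearMap
    ∘ₗ map (cmul k C) (cmul k D)

/-- Left-hand side of condition (CO):
`(id_D⊗id_C⊗Ψ)∘(id_D⊗Δ_C⊗id_D)∘(Ψ⊗id_D)∘(id_C⊗Δ_D)`. -/
def COlhs (Ψ : C ⊗[k] D →ₗ[k] D ⊗[k] C) :
    C ⊗[k] D →ₗ[k] D ⊗[k] (C ⊗[k] (D ⊗[k] C)) :=
  lTensor D ((lTensor C Ψ) ∘ₗ (TensorProduct.assoc k C C D).toLinearMap)
    ∘ₗ lTensor D (rTensor D (cmul k C))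
    ∘ₗ (TensorProduct.assoc k D C D).toLinearMap
    ∘ₗ rTensor D Ψ
    ∘ₗ (TensorProduct.assoc k C D D).symm.toLinearMap
    ∘ₗ lTensor C (cmul k D)

/-- Right-hand side of condition (CO):
`(Ψ⊗id_D⊗id_C)∘(id_C⊗Δ_D⊗id_C)∘(id_C⊗Ψ)∘(Δ_C⊗id_D)`. -/
def COrhs (Ψ : C ⊗[k] D →ₗ[k] D ⊗[k] C) :
    C ⊗[k] D →ₗ[k] D ⊗[k] (C ⊗[k] (D ⊗[k] C)) :=
  (TensorProduct.assoc k D C (D ⊗[k] C)).toLinearMap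
    ∘ₗ rTensor (D ⊗[k] C) Ψ
    ∘ₗ (TensorProduct.assoc k C D (D ⊗[k] C)).symm.toLinearMap
    ∘ₗ lTensor C (TensorProduct.assoc k D D C).toLinearMap
    ∘ₗ lTensor C (rTensor C (cmul k D))
    ∘ₗ lTensor C Ψ
    ∘ₗ (TensorProduct.assoc k C C D).toLinearMap
    ∘ₗ rTensor D (cmul k C)

/-- Condition (CO) on a twist map. -/
def CondCO (Ψ : C ⊗[k] D →ₗ[k] D ⊗[k] C) : Prop := COlhs Ψ = COrhs Ψ

/-- The tensor counit `ε_⊗ = ε_C ⊗ ε_D`. -/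
def tensorCounit : C ⊗[k] D →ₗ[k] k :=
  (TensorProduct.lid k k).toLinearMap ∘ₗ map (eps k C) (eps k D)

/-- `e` is a counit for the coproduct `δ` on `C ⊗ D`. -/
def IsCounit (δ : C ⊗[k] D →ₗ[k] (C ⊗[k] D) ⊗[k] (C ⊗[k] D))
    (e : C ⊗[k] D →ₗ[k] k) : Prop :=
  (TensorProduct.lid k (C ⊗[k] D)).toLinearMap ∘ₗ rTensor (C ⊗[k] D) e ∘ₗ δ = LinearMap.id ∧
  (TensorProduct.rid k (C ⊗[k] D)).toLinearMap ∘ₗ lTensor (C ⊗[k] D) e ∘ₗ δ = LinearMap.id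

/-- Right conormality: `(ε_D⊗id_C)∘Ψ = id_C⊗ε_D`. -/
def RightConormal (Ψ : C ⊗[k] D →ₗ[k] D ⊗[k] C) : Prop :=
  (TensorProduct.lid k C).toLinearMap ∘ₗ rTensor C (eps k D) ∘ₗ Ψ
    = (TensorProduct.rid k C).toLinearMap ∘ₗ lTensor C (eps k D)

/-- Left conormality: `(id_D⊗ε_C)∘Ψ = ε_C⊗id_D`. -/
def LeftConormal (Ψ : C ⊗[k] D →ₗ[k] D ⊗[k] C) : Prop :=
  (TensorProduct.rid k D).toLinearMap ∘ₗ lTensor D (eps k C) ∘ₗ Ψ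
    = (TensorProduct.lid k D).toLinearMap ∘ₗ rTensor D (eps k C)

/-- Conormality of a twist map. -/
def Conormal (Ψ : C ⊗[k] D →ₗ[k] D ⊗[k] C) : Prop :=
  RightConormal Ψ ∧ LeftConormal Ψ

/-- Condition (CP1): `(id_D⊗Ψ)∘(Ψ⊗id_D)∘(id_C⊗Δ_D) = (Δ_D⊗id_C)∘Ψ`. -/
def CP1 (Ψ : C ⊗[k] D →ₗ[k] D ⊗[k] C) : Prop :=
  lTensor D Ψ ∘ₗ (TensorProduct.assoc k D C D).toLinearMap ∘ₗ rTensor D Ψ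
      ∘ₗ (TensorProduct.assoc k C D D).symm.toLinearMap ∘ₗ lTensor C (cmul k D)
    = (TensorProduct.assoc k D D C).toLinearMap ∘ₗ rTensor C (cmul k D) ∘ₗ Ψ

/-- Condition (CP2): `(Ψ⊗id_C)∘(id_C⊗Ψ)∘(Δ_C⊗id_D) = (id_D⊗Δ_C)∘Ψ`. -/
def CP2 (Ψ : C ⊗[k] D →ₗ[k] D ⊗[k] C) : Prop :=
  (TensorProduct.assoc k D C C).toLinearMap ∘ₗ rTensor C Ψ
      ∘ₗ (TensorProduct.assoc k C D C).symm.toLinearMap ∘ₗ lTensor C Ψ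
      ∘ₗ (TensorProduct.assoc k C C D).toLinearMap ∘ₗ rTensor D (cmul k C)
    = lTensor D (cmul k C) ∘ₗ Ψ

/-- The functional `ε_Z := (ε_D⊗ε_C)∘Z`. -/
def epsZ (Z : C ⊗[k] D →ₗ[k] D ⊗[k] C) : C ⊗[k] D →ₗ[k] k :=
  (TensorProduct.lid k k).toLinearMap ∘ₗ map (eps k D) (eps k C) ∘ₗ Z

/-- Right `Z`-conormality: `(ε_Z⊗id_C)∘(id_C⊗Ψ)∘(Δ_C⊗id_D) = id_C⊗ε_D`. -/
def RightZConormal (Ψ Z : C ⊗[k] D →ₗ[k] D ⊗[k] C) : Prop :=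
  (TensorProduct.lid k C).toLinearMap ∘ₗ rTensor C (epsZ Z)
      ∘ₗ (TensorProduct.assoc k C D C).symm.toLinearMap ∘ₗ lTensor C Ψ
      ∘ₗ (TensorProduct.assoc k C C D).toLinearMap ∘ₗ rTensor D (cmul k C)
    = (TensorProduct.rid k C).toLinearMap ∘ₗ lTensor C (eps k D)

/-- Left `Z`-conormality: `(id_D⊗ε_Z)∘(Ψ⊗id_D)∘(id_C⊗Δ_D) = ε_C⊗id_D`. -/
def LeftZConormal (Ψ Z : C ⊗[k] D →ₗ[k] D ⊗[k] C) : Prop :=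
  (TensorProduct.rid k D).toLinearMap ∘ₗ lTensor D (epsZ Z)
      ∘ₗ (TensorProduct.assoc k D C D).toLinearMap ∘ₗ rTensor D Ψ
      ∘ₗ (TensorProduct.assoc k C D D).symm.toLinearMap ∘ₗ lTensor C (cmul k D)
    = (TensorProduct.lid k D).toLinearMap ∘ₗ rTensor D (eps k C)

/-- `Z`-conormality. -/
def ZConormal (Ψ Z : C ⊗[k] D →ₗ[k] D ⊗[k] C) : Prop :=
  RightZConormal Ψ Z ∧ LeftZConormal Ψ Z

/-- The projection `p_C := (id_C⊗e)∘(Δ_C⊗id_D)`. -/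
def pC (e : C ⊗[k] D →ₗ[k] k) : C ⊗[k] D →ₗ[k] C :=
  (TensorProduct.rid k C).toLinearMap ∘ₗ lTensor C e
    ∘ₗ (TensorProduct.assoc k C C D).toLinearMap ∘ₗ rTensor D (cmul k C)

/-- The projection `p_D := (e⊗id_D)∘(id_C⊗Δ_D)`. -/
def pD (e : C ⊗[k] D →ₗ[k] k) : C ⊗[k] D →ₗ[k] D :=
  (TensorProduct.lid k D).toLinearMap ∘ₗ rTensor D e
    ∘ₗ (TensorProduct.assoc k C D D).symm.toLinearMap ∘ₗ lTensor C (cmul k D)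

/-- The projection `π_C = id_C ⊗ ε_D`. -/
def piC : C ⊗[k] D →ₗ[k] C :=
  (TensorProduct.rid k C).toLinearMap ∘ₗ lTensor C (eps k D)

/-- The projection `π_D = ε_C ⊗ id_D`. -/
def piD : C ⊗[k] D →ₗ[k] D :=
  (TensorProduct.lid k D).toLinearMap ∘ₗ rTensor D (eps k C)

/-- Convolution product on `(C⊗D)'`: `(φ∗φ')(c⊗d) = φ(c₁⊗d₁)φ'(c₂⊗d₂)`. -/
def convMul (φ φ' : C ⊗[k] D →ₗ[k] k) : C ⊗[k] D →ₗ[k] k :=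
  (TensorProduct.lid k k).toLinearMap ∘ₗ map φ φ'
    ∘ₗ (tensorTensorTensorComm k C C D D).toLinearMap
    ∘ₗ map (cmul k C) (cmul k D)

/-- `⋆`-product on `(C⊗D)'`: `(φ⋆φ')(c⊗d) = φ(c₂⊗d₁)φ'(c₁⊗d₂)`. -/
def starMul (φ φ' : C ⊗[k] D →ₗ[k] k) : C ⊗[k] D →ₗ[k] k :=
  (TensorProduct.lid k k).toLinearMap ∘ₗ map φ φ'
    ∘ₗ (tensorTensorTensorComm k C C D D).toLinearMap
    ∘ₗ rTensor (D ⊗[k] D) (TensorProduct.comm k C C).toLinearMap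
    ∘ₗ map (cmul k C) (cmul k D)

/-- Condition (LC1): `(Δ_D⊗id_C)∘Ψ' = (id_D⊗Ψ')∘(Δ_D⊗id_C)`. -/
def LC1 (Ψ' : D ⊗[k] C →ₗ[k] D ⊗[k] C) : Prop :=
  (TensorProduct.assoc k D D C).toLinearMap ∘ₗ rTensor C (cmul k D) ∘ₗ Ψ'
    = lTensor D Ψ' ∘ₗ (TensorProduct.assoc k D D C).toLinearMap ∘ₗ rTensor C (cmul k D)

/-- Condition (LC2): `(id_D⊗Δ_C)∘Ψ' = (Ψ'⊗id_C)∘(id_D⊗Δ_C)`. -/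
def LC2 (Ψ' : D ⊗[k] C →ₗ[k] D ⊗[k] C) : Prop :=
  lTensor D (cmul k C) ∘ₗ Ψ'
    = (TensorProduct.assoc k D C C).toLinearMap ∘ₗ rTensor C Ψ'
        ∘ₗ (TensorProduct.assoc k D C C).symm.toLinearMap ∘ₗ lTensor D (cmul k C)

/-- `Ψ' := Ψ ∘ τ`. -/
def psiPrime (Ψ : C ⊗[k] D →ₗ[k] D ⊗[k] C) : D ⊗[k] C →ₗ[k] D ⊗[k] C :=
  Ψ ∘ₗ (TensorProduct.comm k D C).toLinearMap

/-- The twist `Ψ'_φ : d⊗c ↦ φ(c₁⊗d₂) d₁⊗c₂` associated to a functional `φ`. -/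
def PsiPhi (φ : C ⊗[k] D →ₗ[k] k) : D ⊗[k] C →ₗ[k] D ⊗[k] C :=
  (TensorProduct.rid k (D ⊗[k] C)).toLinearMap
    ∘ₗ lTensor (D ⊗[k] C) φ
    ∘ₗ lTensor (D ⊗[k] C) (TensorProduct.comm k D C).toLinearMap
    ∘ₗ (tensorTensorTensorComm k D D C C).toLinearMap
    ∘ₗ lTensor (D ⊗[k] D) (TensorProduct.comm k C C).toLinearMap
    ∘ₗ map (cmul k D) (cmul k C)

/-- The functional `F(Ψ') := (ε_D⊗ε_C)∘Ψ'∘τ` associated to a twist `Ψ' : D⊗C → D⊗C`. -/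
def Ffun (Ψ' : D ⊗[k] C →ₗ[k] D ⊗[k] C) : C ⊗[k] D →ₗ[k] k :=
  (TensorProduct.lid k k).toLinearMap ∘ₗ map (eps k D) (eps k C) ∘ₗ Ψ'
    ∘ₗ (TensorProduct.comm k C D).toLinearMap

/-- The tensor product coproduct `Δ_⊗` on `C ⊗ D`. -/
def tensorComul : C ⊗[k] D →ₗ[k] (C ⊗[k] D) ⊗[k] (C ⊗[k] D) :=
  (tensorTensorTensorComm k C C D D).toLinearMap ∘ₗ map (cmul k C) (cmul k D)

/-- The map `id_C ⊗ Ψ' ⊗ id_D : (C⊗D)⊗(C⊗D) → (C⊗D)⊗(C⊗D)`. -/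
def midMap (Ψ' : D ⊗[k] C →ₗ[k] D ⊗[k] C) :
    (C ⊗[k] D) ⊗[k] (C ⊗[k] D) →ₗ[k] (C ⊗[k] D) ⊗[k] (C ⊗[k] D) :=
  (TensorProduct.assoc k C D (C ⊗[k] D)).symm.toLinearMap
    ∘ₗ lTensor C ((TensorProduct.assoc k D C D).toLinearMap ∘ₗ rTensor D Ψ'
        ∘ₗ (TensorProduct.assoc k D C D).symm.toLinearMap)
    ∘ₗ (TensorProduct.assoc k C D (C ⊗[k] D)).toLinearMap

/-- `C` is co-commutative up to isomorphism: there is a coalgebra isomorphism `C ≅ C^cop`. -/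
def CocommUpToIso (k C : Type*) [CommSemiring k] [AddCommMonoid C] [Module k C]
    [Coalgebra k C] : Prop :=
  ∃ χ : C →ₗ[k] C, Function.Bijective χ ∧
    map χ χ ∘ₗ cmul k C = (TensorProduct.comm k C C).toLinearMap ∘ₗ cmul k C ∘ₗ χ ∧
    eps k C ∘ₗ χ = eps k C

section Contraction

variable {A B E F A' B' E' F' : Type*}
  [AddCommGroup A] [Module k A] [AddCommGroup B] [Module k B]
  [AddCommGroup E] [Module k E] [AddCommGroup F] [Module k F]
  [AddCommGroup A'] [Module k A'] [AddCommGroup B'] [Module k B']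
  [AddCommGroup E'] [Module k E'] [AddCommGroup F'] [Module k F']

/-- Contraction of the two middle factors: `(a⊗b)⊗(f⊗g) ↦ φ(b⊗f) a⊗g`. -/
def contract (φ : B ⊗[k] E →ₗ[k] k) : (A ⊗[k] B) ⊗[k] (E ⊗[k] F) →ₗ[k] A ⊗[k] F :=
  (TensorProduct.lid k (A ⊗[k] F)).toLinearMap ∘ₗ rTensor (A ⊗[k] F) φ
    ∘ₗ (tensorTensorTensorComm k B A E F).toLinearMap
    ∘ₗ rTensor (E ⊗[k] F) (TensorProduct.comm k A B).toLinearMap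

@[simp]
theorem contract_tmul (φ : B ⊗[k] E →ₗ[k] k) (a : A) (b : B) (x : E) (y : F) :
    contract φ ((a ⊗ₜ[k] b) ⊗ₜ[k] (x ⊗ₜ[k] y)) = φ (b ⊗ₜ[k] x) • (a ⊗ₜ[k] y) := by
  simp [contract]

theorem contract_comp_map_inner (φ : B' ⊗[k] E' →ₗ[k] k) (f : B →ₗ[k] B') (g : E →ₗ[k] E') :
    contract (A := A) (F := F) (φ ∘ₗ map f g)
      = contract φ ∘ₗ map (lTensor A f) (rTensor F g) := by
  ext a b x y
  simp

theorem map_comp_contract (φ : B ⊗[k] E →ₗ[k] k) (f : A →ₗ[k] A') (g : F →ₗ[k] F') :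
    map f g ∘ₗ contract φ = contract φ ∘ₗ map (rTensor B f) (lTensor E g) := by
  ext a b x y
  simp

theorem contract_comp_contract (φ : B ⊗[k] E →ₗ[k] k) (φ' : B' ⊗[k] E' →ₗ[k] k) :
    contract φ' ∘ₗ contract (A := A ⊗[k] B') (F := E' ⊗[k] F) φ
      = contract (φ' ∘ₗ contract φ)
        ∘ₗ map (TensorProduct.assoc k A B' B).toLinearMap
          (TensorProduct.assoc k E E' F).symm.toLinearMap := by
  ext a b' b x x' y
  simp [smul_smul]

/-- The map `id ⊗ Ψ ⊗ id`, with the appropriate reassociations. -/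
def middleTwist (Ψ : B ⊗[k] E →ₗ[k] E' ⊗[k] B') :
    (A ⊗[k] B) ⊗[k] (E ⊗[k] F) →ₗ[k] (A ⊗[k] E') ⊗[k] (B' ⊗[k] F) :=
  (TensorProduct.assoc k A E' (B' ⊗[k] F)).symm.toLinearMap
    ∘ₗ lTensor A (TensorProduct.assoc k E' B' F).toLinearMap
    ∘ₗ lTensor A (rTensor F Ψ)
    ∘ₗ lTensor A (TensorProduct.assoc k B E F).symm.toLinearMap
    ∘ₗ (TensorProduct.assoc k A B (E ⊗[k] F)).toLinearMap

theorem map_comp_middleTwist (Ψ : B ⊗[k] E →ₗ[k] E' ⊗[k] B') (f : A →ₗ[k] A')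
    (g : F →ₗ[k] F') :
    map (rTensor E' f) (lTensor B' g) ∘ₗ middleTwist Ψ
      = middleTwist Ψ ∘ₗ map (rTensor B f) (lTensor E g) := by
  ext a b x y
  simp only [middleTwist, AlgebraTensorModule.curry_apply, curry_apply,
    restrictScalars_self, coe_comp, LinearEquiv.coe_coe, Function.comp_apply, assoc_tmul,
    assoc_symm_tmul, lTensor_tmul, rTensor_tmul, map_tmul]
  induction Ψ (b ⊗ₜ[k] x) using TensorProduct.induction_on with
  | zero => simp
  | tmul u v => simp
  | add u v hu hv => simp only [add_tmul, tmul_add, map_add, hu, hv]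

theorem map_contractions_comp_middleTwist (Ψ : B ⊗[k] E →ₗ[k] E' ⊗[k] B')
    (φ : A' ⊗[k] E' →ₗ[k] k) (φ' : B' ⊗[k] F' →ₗ[k] k) :
    map ((TensorProduct.rid k A).toLinearMap ∘ₗ lTensor A φ
          ∘ₗ (TensorProduct.assoc k A A' E').toLinearMap)
        ((TensorProduct.lid k F).toLinearMap ∘ₗ rTensor F φ'
          ∘ₗ (TensorProduct.assoc k B' F' F).symm.toLinearMap)
      ∘ₗ middleTwist Ψ
    = contract (φ' ∘ₗ (TensorProduct.lid k (B' ⊗[k] F')).toLinearMap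
          ∘ₗ rTensor (B' ⊗[k] F') φ ∘ₗ middleTwist Ψ)
        ∘ₗ map (TensorProduct.assoc k A A' B).toLinearMap
          (TensorProduct.assoc k E F' F).symm.toLinearMap := by
  ext a a' b x y' y
  simp only [middleTwist, AlgebraTensorModule.curry_apply, curry_apply,
    restrictScalars_self, coe_comp, LinearEquiv.coe_coe, Function.comp_apply, assoc_tmul,
    assoc_symm_tmul, lTensor_tmul, rTensor_tmul, map_tmul, contract_tmul]
  induction Ψ (b ⊗ₜ[k] x) using TensorProduct.induction_on with
  | zero => simp
  | tmul u v => simp [← smul_tmul', tmul_smul, smul_smul, mul_comm]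
  | add u v hu hv => simp only [add_tmul, tmul_add, map_add, hu, hv, add_smul]

end Contraction

/-- The map `c⊗d ↦ φ(c₂⊗d₁) c₁⊗d₂`. -/
def starMap (φ : C ⊗[k] D →ₗ[k] k) : C ⊗[k] D →ₗ[k] C ⊗[k] D :=
  contract φ ∘ₗ map (cmul k C) (cmul k D)

theorem starMap_comp_comul (φ : (C ⊗[k] C) ⊗[k] (D ⊗[k] D) →ₗ[k] k) :
    starMap (φ ∘ₗ map (cmul k C) (cmul k D))
      = contract φ
        ∘ₗ map (TensorProduct.assoc k C C C).toLinearMap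
          (TensorProduct.assoc k D D D).symm.toLinearMap
        ∘ₗ map (rTensor C (cmul k C)) (lTensor D (cmul k D))
        ∘ₗ map (cmul k C) (cmul k D) := by
  have hC : (TensorProduct.assoc k C C C).toLinearMap ∘ₗ rTensor C (cmul k C) ∘ₗ cmul k C
      = lTensor C (cmul k C) ∘ₗ cmul k C := Coalgebra.coassoc
  have hD : (TensorProduct.assoc k D D D).symm.toLinearMap ∘ₗ lTensor D (cmul k D) ∘ₗ cmul k D
      = rTensor D (cmul k D) ∘ₗ cmul k D := Coalgebra.coassoc_symm
  rw [starMap, contract_comp_map_inner, LinearMap.comp_assoc, ← map_comp, ← map_comp, ← map_comp,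
    hC, hD]

theorem comp_starMap (φ φ' : C ⊗[k] D →ₗ[k] k) : φ' ∘ₗ starMap φ = starMul φ φ' := by
  have h : φ' ∘ₗ contract φ
      = (TensorProduct.lid k k).toLinearMap ∘ₗ map φ φ'
        ∘ₗ (tensorTensorTensorComm k C C D D).toLinearMap
        ∘ₗ rTensor (D ⊗[k] D) (TensorProduct.comm k C C).toLinearMap := by
    ext a b x y
    simp
  rw [starMap, ← LinearMap.comp_assoc, h]
  rfl

theorem starMap_comp_starMap (φ φ' : C ⊗[k] D →ₗ[k] k) :
    starMap φ' ∘ₗ starMap φ = starMap (starMul φ φ') := by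
  rw [← comp_starMap, starMap, starMap, ← LinearMap.comp_assoc _ _ φ', starMap_comp_comul,
    ← LinearMap.comp_assoc, LinearMap.comp_assoc _ _ (contract φ'), map_comp_contract,
    ← LinearMap.comp_assoc, contract_comp_contract]
  rfl

theorem tensorCounit_comp_starMap (φ : C ⊗[k] D →ₗ[k] k) : tensorCounit ∘ₗ starMap φ = φ := by
  have h : tensorCounit ∘ₗ contract φ
      = φ ∘ₗ map ((TensorProduct.lid k C).toLinearMap ∘ₗ rTensor C (eps k C))
          ((TensorProduct.rid k D).toLinearMap ∘ₗ lTensor D (eps k D)) := by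
    ext a b x y
    simp [tensorCounit, ← smul_tmul', tmul_smul, mul_assoc, mul_comm, mul_left_comm]
  have hC : ((TensorProduct.lid k C).toLinearMap ∘ₗ rTensor C (eps k C)) ∘ₗ cmul k C
      = LinearMap.id := by
    ext c
    simp [eps, cmul]
  have hD : ((TensorProduct.rid k D).toLinearMap ∘ₗ lTensor D (eps k D)) ∘ₗ cmul k D
      = LinearMap.id := by
    ext d
    simp [eps, cmul]
  rw [starMap, ← LinearMap.comp_assoc, h, LinearMap.comp_assoc, ← map_comp, hC, hD, map_id,
    LinearMap.comp_id]

theorem starMap_tensorCounit :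
    starMap (tensorCounit : C ⊗[k] D →ₗ[k] k) = LinearMap.id := by
  have h : contract (tensorCounit : C ⊗[k] D →ₗ[k] k)
      = map ((TensorProduct.rid k C).toLinearMap ∘ₗ lTensor C (eps k C))
          ((TensorProduct.lid k D).toLinearMap ∘ₗ rTensor D (eps k D)) := by
    ext a b x y
    simp [tensorCounit, smul_tmul', tmul_smul, smul_smul, mul_comm]
  have hC : ((TensorProduct.rid k C).toLinearMap ∘ₗ lTensor C (eps k C)) ∘ₗ cmul k C
      = LinearMap.id := by
    ext c
    simp [eps, cmul]
  have hD : ((TensorProduct.lid k D).toLinearMap ∘ₗ rTensor D (eps k D)) ∘ₗ cmul k D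
      = LinearMap.id := by
    ext d
    simp [eps, cmul]
  rw [starMap, h, ← map_comp, hC, hD, map_id]

theorem map_pC_pD_comp_twistedComul {Ψ : C ⊗[k] D →ₗ[k] D ⊗[k] C} {e : C ⊗[k] D →ₗ[k] k}
    (he : (TensorProduct.lid k (C ⊗[k] D)).toLinearMap ∘ₗ rTensor (C ⊗[k] D) e
      ∘ₗ twistedComul Ψ = LinearMap.id) :
    map (pC e) (pD e) ∘ₗ twistedComul Ψ = starMap e := by
  have hΨ : twistedComul Ψ = middleTwist Ψ ∘ₗ map (cmul k C) (cmul k D) := rfl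
  have hp : map (pC e) (pD e)
      = map ((TensorProduct.rid k C).toLinearMap ∘ₗ lTensor C e
          ∘ₗ (TensorProduct.assoc k C C D).toLinearMap)
        ((TensorProduct.lid k D).toLinearMap ∘ₗ rTensor D e
          ∘ₗ (TensorProduct.assoc k C D D).symm.toLinearMap)
        ∘ₗ map (rTensor D (cmul k C)) (lTensor C (cmul k D)) := by
    rw [← map_comp]
    rfl
  have hstar : starMap e = starMap ((e ∘ₗ (TensorProduct.lid k (C ⊗[k] D)).toLinearMap
      ∘ₗ rTensor (C ⊗[k] D) e ∘ₗ middleTwist Ψ) ∘ₗ map (cmul k C) (cmul k D)) := by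
    conv_lhs => rw [← LinearMap.comp_id e, ← he, hΨ]
    rfl
  rw [hstar, starMap_comp_comul, hΨ, hp, ← LinearMap.comp_assoc,
    LinearMap.comp_assoc (middleTwist Ψ), map_comp_middleTwist, ← LinearMap.comp_assoc,
    map_contractions_comp_middleTwist]
  rfl

theorem exists_star_inverse_iff_bijective (e : C ⊗[k] D →ₗ[k] k) :
    (∃ es : C ⊗[k] D →ₗ[k] k, starMul e es = tensorCounit ∧ starMul es e = tensorCounit)
      ↔ Function.Bijective (starMap e) := by
  constructor
  · rintro ⟨es, h₁, h₂⟩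
    have h₃ : starMap es ∘ₗ starMap e = LinearMap.id := by
      rw [starMap_comp_starMap, h₁, starMap_tensorCounit]
    have h₄ : starMap e ∘ₗ starMap es = LinearMap.id := by
      rw [starMap_comp_starMap, h₂, starMap_tensorCounit]
    exact Function.bijective_iff_has_inverse.2
      ⟨starMap es, LinearMap.congr_fun h₃, LinearMap.congr_fun h₄⟩
  · intro h
    let T := LinearEquiv.ofBijective (starMap e) h
    have hT : T.symm.toLinearMap ∘ₗ starMap e = LinearMap.id :=
      LinearMap.ext T.symm_apply_apply
    have h₁ : starMul e (tensorCounit ∘ₗ T.symm.toLinearMap) = tensorCounit := by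
      rw [← comp_starMap, LinearMap.comp_assoc, hT, LinearMap.comp_id]
    refine ⟨_, h₁, ?_⟩
    have h₂ : starMap (tensorCounit ∘ₗ T.symm.toLinearMap) = T.symm.toLinearMap := by
      have h₃ := starMap_comp_starMap e (tensorCounit ∘ₗ T.symm.toLinearMap)
      rw [h₁, starMap_tensorCounit, ← hT] at h₃
      exact (LinearMap.cancel_right h.2).1 h₃
    have h₄ : tensorCounit ∘ₗ T.toLinearMap = e := tensorCounit_comp_starMap e
    rw [← comp_starMap, h₂]
    nth_rewrite 1 [← h₄]
    rw [LinearMap.comp_assoc, T.comp_symm, LinearMap.comp_id]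

theorem stmt8 (Ψ : C ⊗[k] D →ₗ[k] D ⊗[k] C) (e : C ⊗[k] D →ₗ[k] k)
    (he : IsCounit (twistedComul Ψ) e) :
    (∃ es : C ⊗[k] D →ₗ[k] k,
        starMul e es = tensorCounit ∧ starMul es e = tensorCounit)
    ↔ Function.Bijective (map (pC e) (pD e) ∘ₗ twistedComul Ψ) := by
  rw [map_pC_pD_comp_twistedComul he.1]
  exact exists_star_inverse_iff_bijective e

end TwistedTensor
end
end

section
/- Let Ψ : C⊗D → D⊗C be a twist map satisfying condition (CO) and let e be a counit for Δ_Ψ. Suppose q_C : C⊗D → C and q_D : C⊗D → D are coalgebra morphisms from (C⊗D, Δ_Ψ, e) to (C, Δ_C, ε_C) and (D, Δ_D, ε_D) respectively, such that μ := (q_C⊗q_D)∘Δ_Ψ : C⊗D → C⊗D is bijective. Then Ψ̃ := (q_D⊗q_C)∘Δ_Ψ∘μ⁻¹ is a conormal twist map satisfying condition (CO), and μ is a coalgebra isomorphism from (C⊗D, Δ_Ψ, e) to (C⊗D, Δ_{Ψ̃}, ε_C⊗ε_D), i.e. (μ⊗μ)∘Δ_Ψ = Δ_{Ψ̃}∘μ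 and (ε_C⊗ε_D)∘μ = e. -/
open TensorProduct LinearMap

noncomputable section
namespace TwistedTensor

variable {k : Type*} [Field k]
variable {C D : Type*} [AddCommGroup C] [Module k C] [AddCommGroup D] [Module k D]
  [Coalgebra k C] [Coalgebra k D]

set_option linter.unusedSectionVars false

/-- The map `id_C ⊗ Ψ ⊗ id_D`, with the outcome regrouped into two copies of `C ⊗ D`. -/
def twistMiddle (Ψ : C ⊗[k] D →ₗ[k] D ⊗[k] C) :
    (C ⊗[k] C) ⊗[k] (D ⊗[k] D) →ₗ[k] (C ⊗[k] D) ⊗[k] (C ⊗[k] D) :=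
  (TensorProduct.assoc k C D (C ⊗[k] D)).symm.toLinearMap
    ∘ₗ lTensor C (TensorProduct.assoc k D C D).toLinearMap
    ∘ₗ lTensor C (rTensor D Ψ)
    ∘ₗ lTensor C (TensorProduct.assoc k C D D).symm.toLinearMap
    ∘ₗ (TensorProduct.assoc k C C (D ⊗[k] D)).toLinearMap

theorem twistMiddle_tmul (Ψ : C ⊗[k] D →ₗ[k] D ⊗[k] C) (a a' : C) (b b' : D) :
    twistMiddle Ψ ((a ⊗ₜ[k] a') ⊗ₜ[k] (b ⊗ₜ[k] b')) =
      (TensorProduct.assoc k C D (C ⊗[k] D)).symm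
        (a ⊗ₜ[k] TensorProduct.assoc k D C D (Ψ (a' ⊗ₜ[k] b) ⊗ₜ[k] b')) := rfl

theorem twistedComul_apply (Ψ : C ⊗[k] D →ₗ[k] D ⊗[k] C) (x : C ⊗[k] D) :
    twistedComul Ψ x = twistMiddle Ψ (map (cmul k C) (cmul k D) x) := rfl

theorem twistedComul_tmul (Ψ : C ⊗[k] D →ₗ[k] D ⊗[k] C) (c : C) (d : D) :
    twistedComul Ψ (c ⊗ₜ[k] d) = twistMiddle Ψ (cmul k C c ⊗ₜ[k] cmul k D d) := rfl

/-- The part of `COlhs` that follows the coproduct of `D`. -/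
def COlhsAux (Ψ : C ⊗[k] D →ₗ[k] D ⊗[k] C) :
    C ⊗[k] (D ⊗[k] D) →ₗ[k] D ⊗[k] (C ⊗[k] (D ⊗[k] C)) :=
  lTensor D ((lTensor C Ψ) ∘ₗ (TensorProduct.assoc k C C D).toLinearMap)
    ∘ₗ lTensor D (rTensor D (cmul k C))
    ∘ₗ (TensorProduct.assoc k D C D).toLinearMap
    ∘ₗ rTensor D Ψ
    ∘ₗ (TensorProduct.assoc k C D D).symm.toLinearMap

theorem COlhsAux_tmul (Ψ : C ⊗[k] D →ₗ[k] D ⊗[k] C) (a : C) (b b' : D) :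
    COlhsAux Ψ (a ⊗ₜ[k] (b ⊗ₜ[k] b')) =
      lTensor D (lTensor C Ψ ∘ₗ (TensorProduct.assoc k C C D).toLinearMap
        ∘ₗ rTensor D (cmul k C)) (TensorProduct.assoc k D C D (Ψ (a ⊗ₜ[k] b) ⊗ₜ[k] b')) := by
  simp [COlhsAux, lTensor_comp]

theorem COlhs_tmul (Ψ : C ⊗[k] D →ₗ[k] D ⊗[k] C) (c : C) (d : D) :
    COlhs Ψ (c ⊗ₜ[k] d) = COlhsAux Ψ (c ⊗ₜ[k] cmul k D d) := rfl

/-- The part of `COrhs` that follows the coproduct of `C`. -/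
def COrhsAux (Ψ : C ⊗[k] D →ₗ[k] D ⊗[k] C) :
    (C ⊗[k] C) ⊗[k] D →ₗ[k] D ⊗[k] (C ⊗[k] (D ⊗[k] C)) :=
  (TensorProduct.assoc k D C (D ⊗[k] C)).toLinearMap
    ∘ₗ rTensor (D ⊗[k] C) Ψ
    ∘ₗ (TensorProduct.assoc k C D (D ⊗[k] C)).symm.toLinearMap
    ∘ₗ lTensor C (TensorProduct.assoc k D D C).toLinearMap
    ∘ₗ lTensor C (rTensor C (cmul k D))
    ∘ₗ lTensor C Ψ
    ∘ₗ (TensorProduct.assoc k C C D).toLinearMap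

theorem COrhsAux_tmul (Ψ : C ⊗[k] D →ₗ[k] D ⊗[k] C) (a a' : C) (b : D) :
    COrhsAux Ψ ((a ⊗ₜ[k] a') ⊗ₜ[k] b) =
      TensorProduct.assoc k D C (D ⊗[k] C) (rTensor (D ⊗[k] C) Ψ
        ((TensorProduct.assoc k C D (D ⊗[k] C)).symm (a ⊗ₜ[k]
          TensorProduct.assoc k D D C (rTensor C (cmul k D) (Ψ (a' ⊗ₜ[k] b)))))) := rfl

theorem COrhs_tmul (Ψ : C ⊗[k] D →ₗ[k] D ⊗[k] C) (c : C) (d : D) :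
    COrhs Ψ (c ⊗ₜ[k] d) = COrhsAux Ψ (cmul k C c ⊗ₜ[k] d) := rfl

variable (k C D) in
/-- The regrouping `c₁ ⊗ (d₁ ⊗ c₂ ⊗ d₂ ⊗ c₃) ⊗ d₃ ↦ (c₁ ⊗ d₁) ⊗ (c₂ ⊗ d₂) ⊗ (c₃ ⊗ d₃)`. -/
def regroup : C ⊗[k] ((D ⊗[k] (C ⊗[k] (D ⊗[k] C))) ⊗[k] D) →ₗ[k]
    (C ⊗[k] D) ⊗[k] ((C ⊗[k] D) ⊗[k] (C ⊗[k] D)) :=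
  lTensor (C ⊗[k] D) ((TensorProduct.assoc k (C ⊗[k] D) C D).toLinearMap
      ∘ₗ rTensor D (TensorProduct.assoc k C D C).symm.toLinearMap)
    ∘ₗ (TensorProduct.assoc k C D _).symm.toLinearMap
    ∘ₗ lTensor C (TensorProduct.assoc k D _ D).toLinearMap

theorem regroup_tmul (c c' c'' : C) (d d' d'' : D) :
    regroup k C D (c ⊗ₜ[k] ((d ⊗ₜ[k] (c' ⊗ₜ[k] (d' ⊗ₜ[k] c''))) ⊗ₜ[k] d'')) =
      (c ⊗ₜ[k] d) ⊗ₜ[k] ((c' ⊗ₜ[k] d') ⊗ₜ[k] (c'' ⊗ₜ[k] d'')) := rfl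

theorem regroup_tmul_tmul (c c' : C) (d d'' : D) (z : D ⊗[k] C) :
    regroup k C D (c ⊗ₜ[k] ((d ⊗ₜ[k] (c' ⊗ₜ[k] z)) ⊗ₜ[k] d'')) =
      (c ⊗ₜ[k] d) ⊗ₜ[k] ((TensorProduct.assoc k C D (C ⊗[k] D)).symm
        (c' ⊗ₜ[k] TensorProduct.assoc k D C D (z ⊗ₜ[k] d''))) := by
  induction z with
  | zero => simp
  | tmul => rfl
  | add x y hx hy => simp only [tmul_add, add_tmul, map_add, hx, hy]

theorem regroup_assoc_tmul (c c'' : C) (d' d'' : D) (z : D ⊗[k] C) :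
    regroup k C D (c ⊗ₜ[k]
        (TensorProduct.assoc k D C (D ⊗[k] C) (z ⊗ₜ[k] (d' ⊗ₜ[k] c'')) ⊗ₜ[k] d'')) =
      TensorProduct.assoc k _ _ _ ((TensorProduct.assoc k C D (C ⊗[k] D)).symm
        (c ⊗ₜ[k] TensorProduct.assoc k D C D (z ⊗ₜ[k] d')) ⊗ₜ[k] (c'' ⊗ₜ[k] d'')) := by
  induction z with
  | zero => simp
  | tmul => rfl
  | add x y hx hy => simp only [tmul_add, add_tmul, map_add, hx, hy]

/-- Both iterates of the coproduct `Δ_Ψ` are of the form `id_C ⊗ T ⊗ id_D` applied to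
`Δ_C ⊗ Δ_D`, where `T` is one of the sides of condition (CO). -/
def iterComul (T : C ⊗[k] D →ₗ[k] D ⊗[k] (C ⊗[k] (D ⊗[k] C))) :
    (C ⊗[k] C) ⊗[k] (D ⊗[k] D) →ₗ[k] (C ⊗[k] D) ⊗[k] ((C ⊗[k] D) ⊗[k] (C ⊗[k] D)) :=
  regroup k C D ∘ₗ lTensor C (rTensor D T)
    ∘ₗ lTensor C (TensorProduct.assoc k C D D).symm.toLinearMap
    ∘ₗ (TensorProduct.assoc k C C (D ⊗[k] D)).toLinearMap

theorem iterComul_tmul (T : C ⊗[k] D →ₗ[k] D ⊗[k] (C ⊗[k] (D ⊗[k] C))) (a a' : C) (b b' : D) :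
    iterComul T ((a ⊗ₜ[k] a') ⊗ₜ[k] (b ⊗ₜ[k] b')) =
      regroup k C D (a ⊗ₜ[k] (T (a' ⊗ₜ[k] b) ⊗ₜ[k] b')) := rfl

theorem cmul_coassoc (c : C) :
    TensorProduct.assoc k C C C (rTensor C (cmul k C) (cmul k C c)) =
      lTensor C (cmul k C) (cmul k C c) :=
  Coalgebra.coassoc_apply c

theorem regroup_COlhsAux (Ψ : C ⊗[k] D →ₗ[k] D ⊗[k] C) (a a' : C) (b : D) (t : D ⊗[k] D) :
    regroup k C D (a ⊗ₜ[k] rTensor D (COlhsAux Ψ) ((TensorProduct.assoc k C _ D).symm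
        (a' ⊗ₜ[k] (TensorProduct.assoc k D D D).symm (b ⊗ₜ[k] t)))) =
      lTensor (C ⊗[k] D) (twistMiddle Ψ) (lTensor (C ⊗[k] D) (rTensor (D ⊗[k] D) (cmul k C))
        ((TensorProduct.assoc k C D _).symm
          (a ⊗ₜ[k] TensorProduct.assoc k D C _ (Ψ (a' ⊗ₜ[k] b) ⊗ₜ[k] t)))) := by
  induction t with
  | zero => simp
  | add x y hx hy => simp only [tmul_add, map_add, hx, hy]
  | tmul t₁ t₂ =>
    simp only [TensorProduct.assoc_symm_tmul, rTensor_tmul, COlhsAux_tmul]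
    generalize Ψ (a' ⊗ₜ[k] b) = w
    induction w with
    | zero => simp
    | add x y hx hy => simp only [tmul_add, add_tmul, map_add, hx, hy]
    | tmul p q =>
      simp only [TensorProduct.assoc_tmul, TensorProduct.assoc_symm_tmul, lTensor_tmul,
        rTensor_tmul, LinearMap.comp_apply]
      generalize cmul k C q = s
      induction s with
      | zero => simp
      | add x y hx hy => simp only [tmul_add, add_tmul, map_add, hx, hy]
      | tmul q₁ q₂ =>
        simp only [LinearEquiv.coe_coe, TensorProduct.assoc_tmul, lTensor_tmul, twistMiddle_tmul,
          regroup_tmul_tmul]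

theorem regroup_COrhsAux (Ψ : C ⊗[k] D →ₗ[k] D ⊗[k] C) (a' : C) (b b' : D) (t : C ⊗[k] C) :
    regroup k C D (lTensor C (rTensor D (COrhsAux Ψ)) (lTensor C
        (TensorProduct.assoc k _ D D).symm.toLinearMap (TensorProduct.assoc k C _ _
          (TensorProduct.assoc k C C C (t ⊗ₜ[k] a') ⊗ₜ[k] (b ⊗ₜ[k] b'))))) =
      TensorProduct.assoc k _ _ _ (rTensor (C ⊗[k] D) (twistMiddle Ψ)
        (rTensor (C ⊗[k] D) (lTensor (C ⊗[k] C) (cmul k D))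
          ((TensorProduct.assoc k _ D _).symm
            (t ⊗ₜ[k] TensorProduct.assoc k D C _ (Ψ (a' ⊗ₜ[k] b) ⊗ₜ[k] b'))))) := by
  induction t with
  | zero => simp
  | add x y hx hy => simp only [add_tmul, map_add, hx, hy]
  | tmul t₁ t₂ =>
    simp only [TensorProduct.assoc_tmul, LinearEquiv.coe_coe, lTensor_tmul,
      TensorProduct.assoc_symm_tmul, rTensor_tmul, COrhsAux_tmul]
    generalize Ψ (a' ⊗ₜ[k] b) = w
    induction w with
    | zero => simp
    | add x y hx hy => simp only [tmul_add, add_tmul, map_add, hx, hy]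
    | tmul p q =>
      simp only [TensorProduct.assoc_tmul, TensorProduct.assoc_symm_tmul, lTensor_tmul,
        rTensor_tmul]
      generalize cmul k D p = s
      induction s with
      | zero => simp
      | add x y hx hy => simp only [tmul_add, add_tmul, map_add, hx, hy]
      | tmul q₁ q₂ =>
        simp only [TensorProduct.assoc_tmul, TensorProduct.assoc_symm_tmul, rTensor_tmul,
          twistMiddle_tmul, regroup_assoc_tmul]

theorem lTensor_twistedComul (Ψ : C ⊗[k] D →ₗ[k] D ⊗[k] C) (c : C) (d : D) :
    lTensor (C ⊗[k] D) (twistedComul Ψ) (twistedComul Ψ (c ⊗ₜ[k] d)) =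
      iterComul (COlhs Ψ) (cmul k C c ⊗ₜ[k] cmul k D d) := by
  have h₁ : ∀ (a a' : C) (v : D ⊗[k] D),
      lTensor (C ⊗[k] D) (twistedComul Ψ) (twistMiddle Ψ ((a ⊗ₜ[k] a') ⊗ₜ[k] v)) =
        regroup k C D (a ⊗ₜ[k] rTensor D (COlhsAux Ψ) ((TensorProduct.assoc k C _ D).symm
          (a' ⊗ₜ[k] (TensorProduct.assoc k D D D).symm (lTensor D (cmul k D) v)))) := by
    intro a a' v
    induction v with
    | zero => simp
    | add x y hx hy => simp only [tmul_add, map_add, hx, hy]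
    | tmul b b' =>
      rw [lTensor_tmul, regroup_COlhsAux, twistMiddle_tmul]
      generalize Ψ (a' ⊗ₜ[k] b) = w
      induction w with
      | zero => simp
      | add x y hx hy => simp only [tmul_add, add_tmul, map_add, hx, hy]
      | tmul p q =>
        simp only [TensorProduct.assoc_tmul, TensorProduct.assoc_symm_tmul, lTensor_tmul,
          rTensor_tmul, twistedComul_tmul]
  have h₂ : ∀ (a a' : C) (v : D ⊗[k] D),
      regroup k C D (a ⊗ₜ[k] rTensor D (COlhsAux Ψ) ((TensorProduct.assoc k C _ D).symm
          (a' ⊗ₜ[k] rTensor D (cmul k D) v))) =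
        iterComul (COlhs Ψ) ((a ⊗ₜ[k] a') ⊗ₜ[k] v) := by
    intro a a' v
    induction v with
    | zero => simp
    | add x y hx hy => simp only [tmul_add, map_add, hx, hy]
    | tmul b b' =>
      simp only [rTensor_tmul, TensorProduct.assoc_symm_tmul, iterComul_tmul, COlhs_tmul]
  rw [twistedComul_tmul]
  generalize cmul k C c = u
  induction u with
  | zero => simp
  | add x y hx hy => simp only [add_tmul, map_add, hx, hy]
  | tmul a a' =>
    rw [h₁, ← cmul_coassoc, LinearEquiv.symm_apply_apply, h₂]

theorem rTensor_twistedComul (Ψ : C ⊗[k] D →ₗ[k] D ⊗[k] C) (c : C) (d : D) :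
    TensorProduct.assoc k _ _ _
        (rTensor (C ⊗[k] D) (twistedComul Ψ) (twistedComul Ψ (c ⊗ₜ[k] d))) =
      iterComul (COrhs Ψ) (cmul k C c ⊗ₜ[k] cmul k D d) := by
  have h₁ : ∀ (u : C ⊗[k] C) (b b' : D),
      TensorProduct.assoc k _ _ _ (rTensor (C ⊗[k] D) (twistedComul Ψ)
          (twistMiddle Ψ (u ⊗ₜ[k] (b ⊗ₜ[k] b')))) =
        regroup k C D (lTensor C (rTensor D (COrhsAux Ψ)) (lTensor C
          (TensorProduct.assoc k _ D D).symm.toLinearMap (TensorProduct.assoc k C _ _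
            (TensorProduct.assoc k C C C (rTensor C (cmul k C) u) ⊗ₜ[k] (b ⊗ₜ[k] b'))))) := by
    intro u b b'
    induction u with
    | zero => simp
    | add x y hx hy => simp only [add_tmul, map_add, hx, hy]
    | tmul a a' =>
      rw [rTensor_tmul, regroup_COrhsAux, twistMiddle_tmul]
      generalize Ψ (a' ⊗ₜ[k] b) = w
      induction w with
      | zero => simp
      | add x y hx hy => simp only [tmul_add, add_tmul, map_add, hx, hy]
      | tmul p q =>
        simp only [TensorProduct.assoc_tmul, TensorProduct.assoc_symm_tmul, lTensor_tmul,
          rTensor_tmul, twistedComul_tmul]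
  have h₂ : ∀ (u : C ⊗[k] C) (b b' : D),
      regroup k C D (lTensor C (rTensor D (COrhsAux Ψ)) (lTensor C
          (TensorProduct.assoc k _ D D).symm.toLinearMap (TensorProduct.assoc k C _ _
            (lTensor C (cmul k C) u ⊗ₜ[k] (b ⊗ₜ[k] b'))))) =
        iterComul (COrhs Ψ) (u ⊗ₜ[k] (b ⊗ₜ[k] b')) := by
    intro u b b'
    induction u with
    | zero => simp
    | add x y hx hy => simp only [add_tmul, map_add, hx, hy]
    | tmul a a' =>
      simp only [rTensor_tmul, lTensor_tmul, TensorProduct.assoc_tmul, LinearEquiv.coe_coe,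
        TensorProduct.assoc_symm_tmul, iterComul_tmul, COrhs_tmul]
  rw [twistedComul_tmul]
  generalize cmul k D d = v
  induction v with
  | zero => simp
  | add x y hx hy => simp only [tmul_add, map_add, hx, hy]
  | tmul b b' => rw [h₁, cmul_coassoc, h₂]

theorem twistedComul_coassoc {Ψ : C ⊗[k] D →ₗ[k] D ⊗[k] C} (h : CondCO Ψ) (x : C ⊗[k] D) :
    TensorProduct.assoc k _ _ _ (rTensor (C ⊗[k] D) (twistedComul Ψ) (twistedComul Ψ x)) =
      lTensor (C ⊗[k] D) (twistedComul Ψ) (twistedComul Ψ x) := by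
  induction x with
  | zero => simp
  | add x y hx hy => simp only [map_add, hx, hy]
  | tmul c d => rw [lTensor_twistedComul, rTensor_twistedComul, show COlhs Ψ = COrhs Ψ from h]

section Transport

variable {X : Type*} [AddCommGroup X] [Module k X] {δ : X →ₗ[k] X ⊗[k] X}

theorem assoc_rTensor_map {A B : Type*} [AddCommGroup A] [Module k A] [AddCommGroup B]
    [Module k B] {δA : A →ₗ[k] A ⊗[k] A} {f : X →ₗ[k] A} (g : X →ₗ[k] B)
    (hf : ∀ x, δA (f x) = map f f (δ x)) (z : X ⊗[k] X) :
    TensorProduct.assoc k A A B (rTensor B δA (map f g z)) =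
      map f (map f g) (TensorProduct.assoc k X X X (rTensor X δ z)) := by
  rw [map_map_assoc]
  congr 1
  induction z with
  | zero => simp
  | add x y hx hy => simp only [map_add, hx, hy]
  | tmul a b => simp only [map_tmul, rTensor_tmul, hf]

variable {qC : X →ₗ[k] C} {qD : X →ₗ[k] D} {Φ : C ⊗[k] D →ₗ[k] D ⊗[k] C}

theorem lTensor_map_lTensor
    (hΦ : ∀ x, Φ (map qC qD (δ x)) = map qD qC (δ x))
    {B : Type*} [AddCommGroup B] [Module k B] (f : X →ₗ[k] B)
    (z : X ⊗[k] X) :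
    lTensor B Φ (map f (map qC qD) (lTensor X δ z)) = map f (map qD qC) (lTensor X δ z) := by
  induction z with
  | zero => simp
  | add x y hx hy => simp only [map_add, hx, hy]
  | tmul a b => simp only [map_tmul, lTensor_tmul, hΦ]

theorem lTensor_assoc_rTensor_map
    (hδ : ∀ x, TensorProduct.assoc k X X X (rTensor X δ (δ x)) = lTensor X δ (δ x))
    (hC : ∀ x, cmul k C (qC x) = map qC qC (δ x))
    (hΦ : ∀ x, Φ (map qC qD (δ x)) = map qD qC (δ x))
    (x : X) :
    lTensor C Φ (TensorProduct.assoc k C C D (rTensor D (cmul k C) (map qC qD (δ x)))) =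
      map qC (map qD qC) (lTensor X δ (δ x)) := by
  rw [assoc_rTensor_map qD hC, hδ, lTensor_map_lTensor hΦ]

theorem COlhs_map
    (hδ : ∀ x, TensorProduct.assoc k X X X (rTensor X δ (δ x)) = lTensor X δ (δ x))
    (hC : ∀ x, cmul k C (qC x) = map qC qC (δ x))
    (hD : ∀ x, cmul k D (qD x) = map qD qD (δ x))
    (hΦ : ∀ x, Φ (map qC qD (δ x)) = map qD qC (δ x))
    (x : X) :
    COlhs Φ (map qC qD (δ x)) =
      map qD (map qC (map qD qC)) (lTensor X (lTensor X δ) (lTensor X δ (δ x))) := by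
  have h₁ : ∀ z, COlhs Φ (map qC qD z) = COlhsAux Φ (map qC (map qD qD) (lTensor X δ z)) := by
    intro z
    induction z with
    | zero => simp
    | add x y hx hy => simp only [map_add, hx, hy]
    | tmul a b => simp only [map_tmul, lTensor_tmul, COlhs_tmul, hD]
  have h₂ : ∀ (w : X ⊗[k] X) (b : X),
      COlhsAux Φ (map qC (map qD qD) (TensorProduct.assoc k X X X (w ⊗ₜ[k] b))) =
        lTensor D (lTensor C Φ ∘ₗ (TensorProduct.assoc k C C D).toLinearMap
          ∘ₗ rTensor D (cmul k C))
            (TensorProduct.assoc k D C D (Φ (map qC qD w) ⊗ₜ[k] qD b)) := by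
    intro w b
    induction w with
    | zero => simp
    | add x y hx hy => simp only [map_add, add_tmul, hx, hy]
    | tmul a a' => simp only [map_tmul, TensorProduct.assoc_tmul, COlhsAux_tmul]
  have h₃ : ∀ z, COlhsAux Φ (map qC (map qD qD)
      (TensorProduct.assoc k X X X (rTensor X δ z))) =
        lTensor D (lTensor C Φ ∘ₗ (TensorProduct.assoc k C C D).toLinearMap
          ∘ₗ rTensor D (cmul k C))
            (map qD (map qC qD) (TensorProduct.assoc k X X X (rTensor X δ z))) := by
    intro z
    induction z with
    | zero => simp
    | add x y hx hy => simp only [map_add, hx, hy]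
    | tmul a b => rw [rTensor_tmul, h₂, hΦ, map_map_assoc, map_tmul]
  rw [h₁, ← hδ, h₃, hδ]
  generalize δ x = z
  induction z with
  | zero => simp
  | add x y hx hy => simp only [map_add, hx, hy]
  | tmul a b =>
    simp only [lTensor_tmul, map_tmul, LinearMap.comp_apply, LinearEquiv.coe_coe,
      lTensor_assoc_rTensor_map hδ hC hΦ]

theorem COrhs_map
    (hδ : ∀ x, TensorProduct.assoc k X X X (rTensor X δ (δ x)) = lTensor X δ (δ x))
    (hC : ∀ x, cmul k C (qC x) = map qC qC (δ x))
    (hD : ∀ x, cmul k D (qD x) = map qD qD (δ x))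
    (hΦ : ∀ x, Φ (map qC qD (δ x)) = map qD qC (δ x))
    (x : X) :
    COrhs Φ (map qC qD (δ x)) =
      map qD (map qC (map qD qC)) (lTensor X (lTensor X δ) (lTensor X δ (δ x))) := by
  have h₁ : ∀ z, lTensor C (TensorProduct.assoc k D D C).toLinearMap
      (lTensor C (rTensor C (cmul k D)) (map qC (map qD qC) (lTensor X δ z))) =
        map qC (map qD (map qD qC)) (lTensor X (lTensor X δ) (lTensor X δ z)) := by
    intro z
    induction z with
    | zero => simp
    | add x y hx hy => simp only [map_add, hx, hy]
    | tmul a b =>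
      simp only [map_tmul, lTensor_tmul, LinearEquiv.coe_coe, assoc_rTensor_map qC hD, hδ]
  have h₂ : ∀ z, lTensor X (lTensor X δ) (TensorProduct.assoc k X X X (rTensor X δ z)) =
      TensorProduct.assoc k X X _ (map δ δ z) := by
    intro z
    rw [lTensor, lTensor, map_map_assoc, TensorProduct.map_id, rTensor, ← LinearMap.comp_apply,
      ← map_comp, LinearMap.id_comp, LinearMap.comp_id]
  have h₃ : ∀ z, rTensor (D ⊗[k] C) Φ (map (map qC qD) (map qD qC) (map δ δ z)) =
      map (map qD qC) (map qD qC) (map δ δ z) := by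
    intro z
    induction z with
    | zero => simp
    | add x y hx hy => simp only [map_add, hx, hy]
    | tmul a b => simp only [map_tmul, rTensor_tmul, hΦ]
  calc COrhs Φ (map qC qD (δ x))
    _ = TensorProduct.assoc k D C (D ⊗[k] C) (rTensor (D ⊗[k] C) Φ
          ((TensorProduct.assoc k C D (D ⊗[k] C)).symm
            (lTensor C (TensorProduct.assoc k D D C).toLinearMap
              (lTensor C (rTensor C (cmul k D)) (lTensor C Φ (TensorProduct.assoc k C C D
                (rTensor D (cmul k C) (map qC qD (δ x))))))))) := rfl
    _ = _ := by
      rw [lTensor_assoc_rTensor_map hδ hC hΦ, h₁, ← hδ, h₂, map_map_assoc,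
        LinearEquiv.symm_apply_apply, h₃, ← map_map_assoc]

theorem twistedComul_map
    (hδ : ∀ x, TensorProduct.assoc k X X X (rTensor X δ (δ x)) = lTensor X δ (δ x))
    (hC : ∀ x, cmul k C (qC x) = map qC qC (δ x))
    (hD : ∀ x, cmul k D (qD x) = map qD qD (δ x))
    (hΦ : ∀ x, Φ (map qC qD (δ x)) = map qD qC (δ x))
    (x : X) :
    twistedComul Φ (map qC qD (δ x)) = map (map qC qD) (map qC qD) (map δ δ (δ x)) := by
  have h₁ : ∀ z : X ⊗[k] X, map (cmul k C) (cmul k D) (map qC qD z) =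
      map (map qC qC) (map qD qD) (map δ δ z) := by
    intro z
    induction z with
    | zero => simp
    | add x y hx hy => simp only [map_add, hx, hy]
    | tmul a b => simp only [map_tmul, hC, hD]
  have h₂ : ∀ z : X ⊗[k] X, map δ δ z = (TensorProduct.assoc k X X _).symm
      (lTensor X (lTensor X δ) (TensorProduct.assoc k X X X (rTensor X δ z))) := by
    intro z
    rw [lTensor, lTensor, map_map_assoc, LinearEquiv.symm_apply_apply, TensorProduct.map_id,
      rTensor, ← LinearMap.comp_apply, ← map_comp, LinearMap.id_comp, LinearMap.comp_id]
  have h₃ : ∀ z : X ⊗[k] X, lTensor X (lTensor X δ) (lTensor X δ z) =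
      lTensor X (TensorProduct.assoc k X X X).toLinearMap
        (lTensor X (rTensor X δ) (lTensor X δ z)) := by
    intro z
    induction z with
    | zero => simp
    | add x y hx hy => simp only [map_add, hx, hy]
    | tmul a b => simp only [lTensor_tmul, LinearEquiv.coe_coe, hδ]
  have h₄ : ∀ (a c : X) (w : X ⊗[k] X),
      twistMiddle Φ (map (map qC qC) (map qD qD) ((TensorProduct.assoc k X X _).symm
        (a ⊗ₜ[k] TensorProduct.assoc k X X X (w ⊗ₜ[k] c)))) =
      (TensorProduct.assoc k C D (C ⊗[k] D)).symm (qC a ⊗ₜ[k]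
        TensorProduct.assoc k D C D (Φ (map qC qD w) ⊗ₜ[k] qD c)) := by
    intro a c w
    induction w with
    | zero => simp
    | add x y hx hy => simp only [map_add, add_tmul, tmul_add, hx, hy]
    | tmul b b' => simp only [map_tmul, TensorProduct.assoc_tmul, TensorProduct.assoc_symm_tmul,
        twistMiddle_tmul]
  have h₅ : ∀ (a c : X) (w : X ⊗[k] X),
      map (map qC qD) (map qC qD) ((TensorProduct.assoc k X X _).symm
        (a ⊗ₜ[k] TensorProduct.assoc k X X X (w ⊗ₜ[k] c))) =
      (TensorProduct.assoc k C D (C ⊗[k] D)).symm (qC a ⊗ₜ[k]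
        TensorProduct.assoc k D C D (map qD qC w ⊗ₜ[k] qD c)) := by
    intro a c w
    induction w with
    | zero => simp
    | add x y hx hy => simp only [map_add, add_tmul, tmul_add, hx, hy]
    | tmul b b' => simp only [map_tmul, TensorProduct.assoc_tmul, TensorProduct.assoc_symm_tmul]
  rw [twistedComul_apply, h₁, h₂, hδ, h₃]
  generalize lTensor X δ (δ x) = z
  induction z with
  | zero => simp
  | add x y hx hy => simp only [map_add, hx, hy]
  | tmul a y =>
    induction y with
    | zero => simp
    | add x y hx hy => simp only [map_add, tmul_add, hx, hy]
    | tmul b c =>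
      simp only [lTensor_tmul, rTensor_tmul, LinearEquiv.coe_coe, h₄, h₅, hΦ]

variable {e : X →ₗ[k] k}

theorem lid_map_apply {A B : Type*} [AddCommGroup A] [Module k A] [AddCommGroup B] [Module k B]
    {εA : A →ₗ[k] k} {f : X →ₗ[k] A} (g : X →ₗ[k] B) (hf : ∀ x, εA (f x) = e x)
    (he : ∀ x, TensorProduct.lid k X (rTensor X e (δ x)) = x) (x : X) :
    TensorProduct.lid k B (rTensor B εA (map f g (δ x))) = g x := by
  conv_rhs => rw [← he x]
  generalize δ x = z
  induction z with
  | zero => simp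
  | add x y hx hy => simp only [map_add, hx, hy]
  | tmul a b => simp [hf]

theorem rid_map_apply {A B : Type*} [AddCommGroup A] [Module k A] [AddCommGroup B] [Module k B]
    {εB : B →ₗ[k] k} (f : X →ₗ[k] A) {g : X →ₗ[k] B} (hg : ∀ x, εB (g x) = e x)
    (he : ∀ x, TensorProduct.rid k X (lTensor X e (δ x)) = x) (x : X) :
    TensorProduct.rid k A (lTensor A εB (map f g (δ x))) = f x := by
  conv_rhs => rw [← he x]
  generalize δ x = z
  induction z with
  | zero => simp
  | add x y hx hy => simp only [map_add, hx, hy]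
  | tmul a b => simp [hg]

end Transport

theorem stmt9 (Ψ : C ⊗[k] D →ₗ[k] D ⊗[k] C) (e : C ⊗[k] D →ₗ[k] k)
    (hco : CondCO Ψ) (he : IsCounit (twistedComul Ψ) e)
    (qC : C ⊗[k] D →ₗ[k] C) (qD : C ⊗[k] D →ₗ[k] D)
    (hqC : map qC qC ∘ₗ twistedComul Ψ = cmul k C ∘ₗ qC) (hqC' : eps k C ∘ₗ qC = e)
    (hqD : map qD qD ∘ₗ twistedComul Ψ = cmul k D ∘ₗ qD) (hqD' : eps k D ∘ₗ qD = e)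
    (hbij : Function.Bijective (map qC qD ∘ₗ twistedComul Ψ)) :
    ∀ Ψt : C ⊗[k] D →ₗ[k] D ⊗[k] C,
      Ψt ∘ₗ (map qC qD ∘ₗ twistedComul Ψ) = map qD qC ∘ₗ twistedComul Ψ →
      Conormal Ψt ∧ CondCO Ψt ∧
      map (map qC qD ∘ₗ twistedComul Ψ) (map qC qD ∘ₗ twistedComul Ψ) ∘ₗ twistedComul Ψ
        = twistedComul Ψt ∘ₗ (map qC qD ∘ₗ twistedComul Ψ) ∧
      tensorCounit ∘ₗ (map qC qD ∘ₗ twistedComul Ψ) = e := by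
  intro Ψt hΨt
  have hδ := twistedComul_coassoc hco
  have hC : ∀ x, cmul k C (qC x) = map qC qC (twistedComul Ψ x) :=
    fun x => (LinearMap.congr_fun hqC x).symm
  have hD : ∀ x, cmul k D (qD x) = map qD qD (twistedComul Ψ x) :=
    fun x => (LinearMap.congr_fun hqD x).symm
  have hΦ : ∀ x, Ψt (map qC qD (twistedComul Ψ x)) = map qD qC (twistedComul Ψ x) :=
    LinearMap.congr_fun hΨt
  have heC : ∀ x, eps k C (qC x) = e x := LinearMap.congr_fun hqC'
  have heD : ∀ x, eps k D (qD x) = e x := LinearMap.congr_fun hqD'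
  have hl : ∀ x, TensorProduct.lid k (C ⊗[k] D) (rTensor (C ⊗[k] D) e (twistedComul Ψ x)) = x :=
    LinearMap.congr_fun he.1
  have hr : ∀ x, TensorProduct.rid k (C ⊗[k] D) (lTensor (C ⊗[k] D) e (twistedComul Ψ x)) = x :=
    LinearMap.congr_fun he.2
  refine ⟨⟨?_, ?_⟩, ?_, ?_, ?_⟩
  · refine (LinearMap.cancel_right hbij.2).1 (LinearMap.ext fun x => ?_)
    simp only [LinearMap.comp_apply, LinearEquiv.coe_coe, hΦ]
    rw [lid_map_apply qC heD hl, rid_map_apply qC heD hr]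
  · refine (LinearMap.cancel_right hbij.2).1 (LinearMap.ext fun x => ?_)
    simp only [LinearMap.comp_apply, LinearEquiv.coe_coe, hΦ]
    rw [rid_map_apply qD heC hr, lid_map_apply qD heC hl]
  · refine (LinearMap.cancel_right hbij.2).1 (LinearMap.ext fun x => ?_)
    simp only [LinearMap.comp_apply]
    rw [COlhs_map hδ hC hD hΦ, COrhs_map hδ hC hD hΦ]
  · refine LinearMap.ext fun x => ?_
    simp only [LinearMap.comp_apply, twistedComul_map hδ hC hD hΦ, map_comp]
  · refine LinearMap.ext fun x => ?_
    rw [← heD x, ← lid_map_apply qD heC hl x]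
    simp only [LinearMap.comp_apply, tensorCounit]
    generalize map qC qD (twistedComul Ψ x) = z
    induction z with
    | zero => simp
    | add x y hx hy => simp only [map_add, hx, hy]
    | tmul a b => simp

end TwistedTensor
end
end

section
/- Let Ψ : C⊗D → D⊗C be a twist map satisfying condition (CO), let e be a counit for Δ_Ψ, and let p_C := (id_C⊗e)∘(Δ_C⊗id_D), p_D := (e⊗id_D)∘(id_C⊗Δ_D). Let Y be a coassociative counital k-coalgebra and u_C : Y → C, u_D : Y → D coalgebra morphisms such that (u_D⊗u_C)∘Δ_Y = Ψ∘(u_C⊗u_D)∘Δ_Y and e∘(u_C⊗u_D)∘Δ_Y = ε_Y. Then ω := (u_C⊗u_D)∘Δ_Y : Y → C⊗D is a coalgebra morphism from (Y, Δ_Y, ε_Y) to (C⊗D, Δ_Ψ, e) satisfying p_C∘ω = u_C and p_D∘ω = u_D. -/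
open TensorProduct LinearMap

noncomputable section
namespace TwistedTensor

variable {k : Type*} [Field k]
variable {C D : Type*} [AddCommGroup C] [Module k C] [AddCommGroup D] [Module k D]
  [Coalgebra k C] [Coalgebra k D]

section Coalgebra

variable {Y : Type*} [AddCommGroup Y] [Module k Y] [Coalgebra k Y]

theorem assoc_rTensor_cmul_cmul :
    (TensorProduct.assoc k Y Y Y).toLinearMap ∘ₗ rTensor Y (cmul k Y) ∘ₗ cmul k Y
      = lTensor Y (cmul k Y) ∘ₗ cmul k Y :=
  Coalgebra.coassoc

/-- Both sides are `y ↦ y₁ ⊗ ((y₂ ⊗ y₃) ⊗ y₄)`. -/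
theorem assoc_map_cmul_cmul :
    lTensor Y (TensorProduct.assoc k Y Y Y).symm.toLinearMap
        ∘ₗ (TensorProduct.assoc k Y Y (Y ⊗[k] Y)).toLinearMap
        ∘ₗ map (cmul k Y) (cmul k Y) ∘ₗ cmul k Y
      = lTensor Y (rTensor Y (cmul k Y) ∘ₗ cmul k Y) ∘ₗ cmul k Y := by
  have h₁ : (TensorProduct.assoc k Y Y (Y ⊗[k] Y)).toLinearMap ∘ₗ map (cmul k Y) (cmul k Y)
      = lTensor Y (lTensor Y (cmul k Y)) ∘ₗ (TensorProduct.assoc k Y Y Y).toLinearMap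
        ∘ₗ rTensor Y (cmul k Y) := by
    rw [← lTensor_comp_rTensor, ← LinearMap.comp_assoc, ← LinearMap.comp_assoc]
    congr 1
    ext; simp
  have h₂ : (TensorProduct.assoc k Y Y Y).symm.toLinearMap ∘ₗ lTensor Y (cmul k Y) ∘ₗ cmul k Y
      = rTensor Y (cmul k Y) ∘ₗ cmul k Y := by
    rw [← assoc_rTensor_cmul_cmul, ← LinearMap.comp_assoc]
    ext; simp
  rw [← h₂]
  simp only [lTensor_comp, LinearMap.comp_assoc]
  rw [← assoc_rTensor_cmul_cmul, ← LinearMap.comp_assoc (cmul k Y), h₁]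
  simp only [LinearMap.comp_assoc]

/-- If `uC` and `uD` are comultiplicative and intertwined by `Ψ`, then `(uC ⊗ uD) ∘ Δ_Y` is
comultiplicative for the twisted coproduct. -/
theorem twistedComul_comp_map_comp_cmul (Ψ : C ⊗[k] D →ₗ[k] D ⊗[k] C)
    (uC : Y →ₗ[k] C) (uD : Y →ₗ[k] D)
    (huC : map uC uC ∘ₗ cmul k Y = cmul k C ∘ₗ uC)
    (huD : map uD uD ∘ₗ cmul k Y = cmul k D ∘ₗ uD)
    (hint : map uD uC ∘ₗ cmul k Y = Ψ ∘ₗ map uC uD ∘ₗ cmul k Y) :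
    twistedComul Ψ ∘ₗ (map uC uD ∘ₗ cmul k Y)
      = map (map uC uD ∘ₗ cmul k Y) (map uC uD ∘ₗ cmul k Y) ∘ₗ cmul k Y := by
  have hmap : map (cmul k C) (cmul k D) ∘ₗ map uC uD
      = map (map uC uC) (map uD uD) ∘ₗ map (cmul k Y) (cmul k Y) := by
    rw [← TensorProduct.map_comp, ← TensorProduct.map_comp, huC, huD]
  have hsplit : lTensor C (TensorProduct.assoc k C D D).symm.toLinearMap
        ∘ₗ (TensorProduct.assoc k C C (D ⊗[k] D)).toLinearMap
        ∘ₗ map (map uC uC) (map uD uD)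
      = map uC (map (map uC uD) uD) ∘ₗ lTensor Y (TensorProduct.assoc k Y Y Y).symm.toLinearMap
        ∘ₗ (TensorProduct.assoc k Y Y (Y ⊗[k] Y)).toLinearMap := by
    ext; simp
  have hmid : lTensor C (rTensor D Ψ) ∘ₗ map uC (map (map uC uD) uD)
        ∘ₗ lTensor Y (rTensor Y (cmul k Y) ∘ₗ cmul k Y)
      = map uC (map (map uD uC) uD) ∘ₗ lTensor Y (rTensor Y (cmul k Y) ∘ₗ cmul k Y) := by
    simp only [lTensor, rTensor, ← TensorProduct.map_comp, ← LinearMap.comp_assoc,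
      LinearMap.comp_id, LinearMap.id_comp]
    rw [hint, LinearMap.comp_assoc]
  have hjoin : (TensorProduct.assoc k C D (C ⊗[k] D)).symm.toLinearMap
        ∘ₗ lTensor C (TensorProduct.assoc k D C D).toLinearMap
        ∘ₗ map uC (map (map uD uC) uD)
        ∘ₗ lTensor Y (TensorProduct.assoc k Y Y Y).symm.toLinearMap
        ∘ₗ (TensorProduct.assoc k Y Y (Y ⊗[k] Y)).toLinearMap
      = map (map uC uD) (map uC uD) := by
    ext; simp
  calc twistedComul Ψ ∘ₗ (map uC uD ∘ₗ cmul k Y)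
      = (TensorProduct.assoc k C D (C ⊗[k] D)).symm.toLinearMap
        ∘ₗ lTensor C (TensorProduct.assoc k D C D).toLinearMap
        ∘ₗ lTensor C (rTensor D Ψ)
        ∘ₗ (lTensor C (TensorProduct.assoc k C D D).symm.toLinearMap
          ∘ₗ (TensorProduct.assoc k C C (D ⊗[k] D)).toLinearMap
          ∘ₗ (map (cmul k C) (cmul k D) ∘ₗ map uC uD)) ∘ₗ cmul k Y := rfl
    _ = (TensorProduct.assoc k C D (C ⊗[k] D)).symm.toLinearMap
        ∘ₗ lTensor C (TensorProduct.assoc k D C D).toLinearMap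
        ∘ₗ lTensor C (rTensor D Ψ)
        ∘ₗ (lTensor C (TensorProduct.assoc k C D D).symm.toLinearMap
          ∘ₗ (TensorProduct.assoc k C C (D ⊗[k] D)).toLinearMap
          ∘ₗ map (map uC uC) (map uD uD)) ∘ₗ map (cmul k Y) (cmul k Y) ∘ₗ cmul k Y := by
      rw [hmap]; rfl
    _ = (TensorProduct.assoc k C D (C ⊗[k] D)).symm.toLinearMap
        ∘ₗ lTensor C (TensorProduct.assoc k D C D).toLinearMap
        ∘ₗ lTensor C (rTensor D Ψ)
        ∘ₗ map uC (map (map uC uD) uD)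
        ∘ₗ (lTensor Y (TensorProduct.assoc k Y Y Y).symm.toLinearMap
          ∘ₗ (TensorProduct.assoc k Y Y (Y ⊗[k] Y)).toLinearMap
          ∘ₗ map (cmul k Y) (cmul k Y) ∘ₗ cmul k Y) := by
      rw [hsplit]; rfl
    _ = (TensorProduct.assoc k C D (C ⊗[k] D)).symm.toLinearMap
        ∘ₗ lTensor C (TensorProduct.assoc k D C D).toLinearMap
        ∘ₗ (lTensor C (rTensor D Ψ) ∘ₗ map uC (map (map uC uD) uD)
          ∘ₗ lTensor Y (rTensor Y (cmul k Y) ∘ₗ cmul k Y)) ∘ₗ cmul k Y := by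
      rw [assoc_map_cmul_cmul]; rfl
    _ = (TensorProduct.assoc k C D (C ⊗[k] D)).symm.toLinearMap
        ∘ₗ lTensor C (TensorProduct.assoc k D C D).toLinearMap
        ∘ₗ map uC (map (map uD uC) uD)
        ∘ₗ (lTensor Y (rTensor Y (cmul k Y) ∘ₗ cmul k Y) ∘ₗ cmul k Y) := by
      rw [hmid]; rfl
    _ = ((TensorProduct.assoc k C D (C ⊗[k] D)).symm.toLinearMap
        ∘ₗ lTensor C (TensorProduct.assoc k D C D).toLinearMap
        ∘ₗ map uC (map (map uD uC) uD)
        ∘ₗ lTensor Y (TensorProduct.assoc k Y Y Y).symm.toLinearMap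
        ∘ₗ (TensorProduct.assoc k Y Y (Y ⊗[k] Y)).toLinearMap)
        ∘ₗ map (cmul k Y) (cmul k Y) ∘ₗ cmul k Y := by
      rw [← assoc_map_cmul_cmul]; rfl
    _ = map (map uC uD ∘ₗ cmul k Y) (map uC uD ∘ₗ cmul k Y) ∘ₗ cmul k Y := by
      rw [hjoin, TensorProduct.map_comp, LinearMap.comp_assoc]

theorem pC_comp_map_comp_cmul (e : C ⊗[k] D →ₗ[k] k) (uC : Y →ₗ[k] C) (uD : Y →ₗ[k] D)
    (huC : map uC uC ∘ₗ cmul k Y = cmul k C ∘ₗ uC)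
    (hcou : e ∘ₗ (map uC uD ∘ₗ cmul k Y) = eps k Y) :
    pC e ∘ₗ (map uC uD ∘ₗ cmul k Y) = uC := by
  have hmap : rTensor D (cmul k C) ∘ₗ map uC uD
      = map (map uC uC) uD ∘ₗ rTensor Y (cmul k Y) := by
    simp only [rTensor, ← TensorProduct.map_comp, huC, LinearMap.comp_id, LinearMap.id_comp]
  have hassoc : (TensorProduct.assoc k C C D).toLinearMap ∘ₗ map (map uC uC) uD
      = map uC (map uC uD) ∘ₗ (TensorProduct.assoc k Y Y Y).toLinearMap := by
    ext; simp
  have hcounit : lTensor C e ∘ₗ map uC (map uC uD) ∘ₗ lTensor Y (cmul k Y)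
      = rTensor k uC ∘ₗ lTensor Y (eps k Y) := by
    simp only [lTensor, rTensor, ← TensorProduct.map_comp, LinearMap.comp_id, LinearMap.id_comp,
      hcou]
  calc pC e ∘ₗ (map uC uD ∘ₗ cmul k Y)
      = (TensorProduct.rid k C).toLinearMap ∘ₗ lTensor C e
        ∘ₗ (TensorProduct.assoc k C C D).toLinearMap
        ∘ₗ (rTensor D (cmul k C) ∘ₗ map uC uD) ∘ₗ cmul k Y := rfl
    _ = (TensorProduct.rid k C).toLinearMap ∘ₗ lTensor C e
        ∘ₗ ((TensorProduct.assoc k C C D).toLinearMap ∘ₗ map (map uC uC) uD)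
        ∘ₗ rTensor Y (cmul k Y) ∘ₗ cmul k Y := by rw [hmap]; rfl
    _ = (TensorProduct.rid k C).toLinearMap ∘ₗ lTensor C e ∘ₗ map uC (map uC uD)
        ∘ₗ ((TensorProduct.assoc k Y Y Y).toLinearMap ∘ₗ rTensor Y (cmul k Y) ∘ₗ cmul k Y) := by
      rw [hassoc]; rfl
    _ = (TensorProduct.rid k C).toLinearMap
        ∘ₗ (lTensor C e ∘ₗ map uC (map uC uD) ∘ₗ lTensor Y (cmul k Y)) ∘ₗ cmul k Y := by
      rw [assoc_rTensor_cmul_cmul]; rfl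
    _ = uC := by
      rw [hcounit]
      ext y
      change TensorProduct.rid k C (rTensor k uC (Coalgebra.counit.lTensor Y (Coalgebra.comul y))) = _
      rw [Coalgebra.lTensor_counit_comul]
      simp

theorem pD_comp_map_comp_cmul (e : C ⊗[k] D →ₗ[k] k) (uC : Y →ₗ[k] C) (uD : Y →ₗ[k] D)
    (huD : map uD uD ∘ₗ cmul k Y = cmul k D ∘ₗ uD)
    (hcou : e ∘ₗ (map uC uD ∘ₗ cmul k Y) = eps k Y) :
    pD e ∘ₗ (map uC uD ∘ₗ cmul k Y) = uD := by
  have hmap : lTensor C (cmul k D) ∘ₗ map uC uD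
      = map uC (map uD uD) ∘ₗ lTensor Y (cmul k Y) := by
    simp only [lTensor, ← TensorProduct.map_comp, huD, LinearMap.comp_id, LinearMap.id_comp]
  have hassoc : (TensorProduct.assoc k C D D).symm.toLinearMap ∘ₗ map uC (map uD uD)
        ∘ₗ (TensorProduct.assoc k Y Y Y).toLinearMap
      = map (map uC uD) uD := by
    ext; simp
  have hcounit : rTensor D e ∘ₗ map (map uC uD) uD ∘ₗ rTensor Y (cmul k Y)
      = lTensor k uD ∘ₗ rTensor Y (eps k Y) := by
    simp only [lTensor, rTensor, ← TensorProduct.map_comp, LinearMap.comp_id, LinearMap.id_comp,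
      hcou]
  calc pD e ∘ₗ (map uC uD ∘ₗ cmul k Y)
      = (TensorProduct.lid k D).toLinearMap ∘ₗ rTensor D e
        ∘ₗ (TensorProduct.assoc k C D D).symm.toLinearMap
        ∘ₗ (lTensor C (cmul k D) ∘ₗ map uC uD) ∘ₗ cmul k Y := rfl
    _ = (TensorProduct.lid k D).toLinearMap ∘ₗ rTensor D e
        ∘ₗ (TensorProduct.assoc k C D D).symm.toLinearMap ∘ₗ map uC (map uD uD)
        ∘ₗ (lTensor Y (cmul k Y) ∘ₗ cmul k Y) := by rw [hmap]; rfl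
    _ = (TensorProduct.lid k D).toLinearMap ∘ₗ rTensor D e
        ∘ₗ ((TensorProduct.assoc k C D D).symm.toLinearMap ∘ₗ map uC (map uD uD)
          ∘ₗ (TensorProduct.assoc k Y Y Y).toLinearMap)
        ∘ₗ rTensor Y (cmul k Y) ∘ₗ cmul k Y := by
      rw [← assoc_rTensor_cmul_cmul]; rfl
    _ = (TensorProduct.lid k D).toLinearMap
        ∘ₗ (rTensor D e ∘ₗ map (map uC uD) uD ∘ₗ rTensor Y (cmul k Y)) ∘ₗ cmul k Y := by
      rw [hassoc]; rfl
    _ = uD := by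
      rw [hcounit]
      ext y
      change TensorProduct.lid k D (lTensor k uD (Coalgebra.counit.rTensor Y (Coalgebra.comul y))) = _
      rw [Coalgebra.rTensor_counit_comul]
      simp

end Coalgebra

theorem stmt10 {Y : Type*} [AddCommGroup Y] [Module k Y] [Coalgebra k Y]
    (Ψ : C ⊗[k] D →ₗ[k] D ⊗[k] C) (e : C ⊗[k] D →ₗ[k] k)
    (hco : CondCO Ψ) (he : IsCounit (twistedComul Ψ) e)
    (uC : Y →ₗ[k] C) (uD : Y →ₗ[k] D)
    (huC : map uC uC ∘ₗ cmul k Y = cmul k C ∘ₗ uC) (huC' : eps k C ∘ₗ uC = eps k Y)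
    (huD : map uD uD ∘ₗ cmul k Y = cmul k D ∘ₗ uD) (huD' : eps k D ∘ₗ uD = eps k Y)
    (hint : map uD uC ∘ₗ cmul k Y = Ψ ∘ₗ map uC uD ∘ₗ cmul k Y)
    (hcou : e ∘ₗ (map uC uD ∘ₗ cmul k Y) = eps k Y) :
    map (map uC uD ∘ₗ cmul k Y) (map uC uD ∘ₗ cmul k Y) ∘ₗ cmul k Y
      = twistedComul Ψ ∘ₗ (map uC uD ∘ₗ cmul k Y) ∧
    e ∘ₗ (map uC uD ∘ₗ cmul k Y) = eps k Y ∧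
    pC e ∘ₗ (map uC uD ∘ₗ cmul k Y) = uC ∧
    pD e ∘ₗ (map uC uD ∘ₗ cmul k Y) = uD :=
  ⟨(twistedComul_comp_map_comp_cmul Ψ uC uD huC huD hint).symm, hcou,
    pC_comp_map_comp_cmul e uC uD huC hcou, pD_comp_map_comp_cmul e uC uD huD hcou⟩

end TwistedTensor
end
end

section
/- Let Ψ : C⊗D → D⊗C be a twist map such that Ψ' := Ψ∘τ satisfies conditions (LC1) and (LC2). Then Ψ is conormal if and only if Ψ = τ_{C,D}, the flip map c⊗d ↦ d⊗c. -/
open TensorProduct LinearMap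

noncomputable section
namespace TwistedTensor

variable {k : Type*} [Field k]
variable {C D : Type*} [AddCommGroup C] [Module k C] [AddCommGroup D] [Module k D]
  [Coalgebra k C] [Coalgebra k D]

/-- The counit law for `D`, tensored with a module `M`. -/
theorem lTensor_counit_comul {M : Type*} [AddCommGroup M] [Module k M] :
    lTensor D ((TensorProduct.lid k M).toLinearMap ∘ₗ rTensor M (eps k D))
      ∘ₗ (TensorProduct.assoc k D D M).toLinearMap ∘ₗ rTensor M (cmul k D) = LinearMap.id := by
  have h : lTensor D ((TensorProduct.lid k M).toLinearMap ∘ₗ rTensor M (eps k D))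
      ∘ₗ (TensorProduct.assoc k D D M).toLinearMap
      = rTensor M ((TensorProduct.rid k D).toLinearMap ∘ₗ lTensor D (eps k D)) := by
    ext a b c
    simp [TensorProduct.smul_tmul]
  have h' : (TensorProduct.rid k D).toLinearMap ∘ₗ lTensor D (eps k D) ∘ₗ cmul k D
      = LinearMap.id := by
    ext d
    simp [eps, cmul]
  rw [← LinearMap.comp_assoc, h, ← rTensor_comp, LinearMap.comp_assoc, h', rTensor_id]

/-- A map satisfying `LC1` is determined by its composition with `ε_D ⊗ id_M`. -/
theorem LC1.eq_lTensor_comp {M : Type*} [AddCommGroup M] [Module k M]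
    {Φ : D ⊗[k] M →ₗ[k] D ⊗[k] M} (h : LC1 Φ) :
    Φ = lTensor D ((TensorProduct.lid k M).toLinearMap ∘ₗ rTensor M (eps k D) ∘ₗ Φ)
      ∘ₗ (TensorProduct.assoc k D D M).toLinearMap ∘ₗ rTensor M (cmul k D) := by
  rw [lTensor_comp, lTensor_comp, LinearMap.comp_assoc, LinearMap.comp_assoc, ← h]
  simpa only [lTensor_comp, LinearMap.comp_assoc, LinearMap.id_comp] using
    (congrArg (· ∘ₗ Φ) (lTensor_counit_comul (k := k) (D := D) (M := M))).symm

theorem stmt12 (Ψ : C ⊗[k] D →ₗ[k] D ⊗[k] C)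
    (h1 : LC1 (psiPrime Ψ)) (h2 : LC2 (psiPrime Ψ)) :
    Conormal Ψ ↔ Ψ = (TensorProduct.comm k C D).toLinearMap := by
  constructor
  · rintro ⟨hr, -⟩
    have hE : (TensorProduct.lid k C).toLinearMap ∘ₗ rTensor C (eps k D) ∘ₗ psiPrime Ψ
        = (TensorProduct.lid k C).toLinearMap ∘ₗ rTensor C (eps k D) := by
      ext d c
      simpa [psiPrime] using LinearMap.congr_fun hr (c ⊗ₜ[k] d)
    have hid : psiPrime Ψ = LinearMap.id := by
      rw [h1.eq_lTensor_comp, hE, lTensor_counit_comul]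
    ext c d
    simpa [psiPrime] using LinearMap.congr_fun hid (d ⊗ₜ[k] c)
  · rintro rfl
    constructor
    · unfold RightConormal
      ext c d
      simp
    · unfold LeftConormal
      ext c d
      simp

end TwistedTensor
end
end

section
/- For a linear functional φ : C⊗D → k, define Ψ'_φ : D⊗C → D⊗C by Ψ'_φ(d⊗c) = φ(c₍₁₎⊗d₍₂₎) d₍₁₎⊗c₍₂₎, and for a linear map Ψ' : D⊗C → D⊗C define F(Ψ') := (ε_D⊗ε_C)∘Ψ'∘τ : C⊗D → k. Then: (a) for every φ, the map Ψ'_φ satisfies conditions (LC1) and (LC2); (b) F(Ψ'_φ) = φ for every φ; (c) if Ψ' satisfies (LC1) and (LC2), then Ψ'_{F(Ψ')} = Ψ'; (d) if Ψ'_1 and Ψ'_2 satisfy (LC1) and (LC2), then F(Ψ'_2 ∘ Ψ'_1) = F(Ψ'_2) ⋆ F(Ψ'_1); (e) F(id_{D⊗C}) = ε_C⊗ε_D. Hence F is an algebra isomorphism from the algebra of solutions of (LC1),(LC2) under composition onto ((C⊗D)', ⋆). -/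
open TensorProduct LinearMap

noncomputable section
namespace TwistedTensor

variable {k : Type*} [Field k]
variable {C D : Type*} [AddCommGroup C] [Module k C] [AddCommGroup D] [Module k D]
  [Coalgebra k C] [Coalgebra k D]

/-- The right slice `d ↦ f(d₂) d₁` of the coproduct by a functional `f`. -/
def sliceRight (f : D →ₗ[k] k) : D →ₗ[k] D :=
  (TensorProduct.rid k D).toLinearMap ∘ₗ lTensor D f ∘ₗ cmul k D

/-- The left slice `c ↦ g(c₁) c₂` of the coproduct by a functional `g`. -/
def sliceLeft (g : C →ₗ[k] k) : C →ₗ[k] C :=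
  (TensorProduct.lid k C).toLinearMap ∘ₗ rTensor C g ∘ₗ cmul k C

theorem exists_cmul_eq_sum (c : C) :
    ∃ (s : Finset (C × C)), cmul k C c = ∑ i ∈ s, i.1 ⊗ₜ[k] i.2 :=
  TensorProduct.exists_finset _

theorem cmul_sliceRight (f : D →ₗ[k] k) (d : D) :
    cmul k D (sliceRight f d) = lTensor D (sliceRight f) (cmul k D d) := by
  have hco : TensorProduct.assoc k D D D (rTensor D (cmul k D) (cmul k D d)) =
      lTensor D (cmul k D) (cmul k D d) := Coalgebra.coassoc_apply d
  have hleft : ∀ w : D ⊗[k] D,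
      cmul k D (TensorProduct.rid k D (lTensor D f w)) =
        lTensor D ((TensorProduct.rid k D).toLinearMap ∘ₗ lTensor D f)
          (TensorProduct.assoc k D D D (rTensor D (cmul k D) w)) := by
    intro w
    induction w with
    | zero => simp
    | add a b ha hb => simp only [map_add, ha, hb]
    | tmul x y =>
      simp only [lTensor_tmul, rTensor_tmul, TensorProduct.rid_tmul, map_smul]
      induction cmul k D x with
      | zero => simp
      | add a b ha hb => simp only [smul_add, add_tmul, map_add, ha, hb]
      | tmul a b => simp
  simp only [sliceRight, lTensor_comp, LinearMap.comp_apply, LinearEquiv.coe_coe] at hleft ⊢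
  rw [hleft, hco]

theorem cmul_sliceLeft (g : C →ₗ[k] k) (c : C) :
    cmul k C (sliceLeft g c) = rTensor C (sliceLeft g) (cmul k C c) := by
  have hco : (TensorProduct.assoc k C C C).symm (lTensor C (cmul k C) (cmul k C c)) =
      rTensor C (cmul k C) (cmul k C c) := Coalgebra.coassoc_symm_apply c
  have hright : ∀ w : C ⊗[k] C,
      cmul k C (TensorProduct.lid k C (rTensor C g w)) =
        rTensor C ((TensorProduct.lid k C).toLinearMap ∘ₗ rTensor C g)
          ((TensorProduct.assoc k C C C).symm (lTensor C (cmul k C) w)) := by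
    intro w
    induction w with
    | zero => simp
    | add a b ha hb => simp only [map_add, ha, hb]
    | tmul x y =>
      simp only [lTensor_tmul, rTensor_tmul, TensorProduct.lid_tmul, map_smul]
      induction cmul k C y with
      | zero => simp
      | add a b ha hb => simp only [smul_add, tmul_add, map_add, ha, hb]
      | tmul a b => simp [smul_tmul']
  simp only [sliceLeft, rTensor_comp, LinearMap.comp_apply, LinearEquiv.coe_coe] at hright ⊢
  rw [hright, hco]

theorem eps_sliceRight (f : D →ₗ[k] k) (d : D) : eps k D (sliceRight f d) = f d := by
  have hcounit : rTensor D (eps k D) (cmul k D d) = 1 ⊗ₜ d :=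
    Coalgebra.rTensor_counit_comul d
  have h : ∀ w : D ⊗[k] D, eps k D (TensorProduct.rid k D (lTensor D f w)) =
      f (TensorProduct.lid k D (rTensor D (eps k D) w)) := by
    intro w
    induction w with
    | zero => simp
    | add a b ha hb => simp only [map_add, ha, hb]
    | tmul x y => simp [mul_comm]
  simpa [sliceRight, hcounit] using h (cmul k D d)

theorem PsiPhi_tmul_of_cmul_right (φ : C ⊗[k] D →ₗ[k] k) (d : D) (c : C) (s : Finset (C × C))
    (hs : cmul k C c = ∑ i ∈ s, i.1 ⊗ₜ[k] i.2) :
    PsiPhi φ (d ⊗ₜ c) = ∑ i ∈ s, sliceRight (φ ∘ₗ TensorProduct.mk k C D i.1) d ⊗ₜ[k] i.2 := by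
  simp only [PsiPhi, sliceRight, LinearMap.comp_apply, LinearEquiv.coe_coe, map_tmul, hs,
    tmul_sum, map_sum]
  refine Finset.sum_congr rfl fun i _ => ?_
  induction cmul k D d with
  | zero => simp
  | add a b ha hb => simp only [add_tmul, map_add, ha, hb]
  | tmul a b => simp [smul_tmul']

theorem PsiPhi_tmul_of_cmul_left (φ : C ⊗[k] D →ₗ[k] k) (d : D) (c : C) (s : Finset (D × D))
    (hs : cmul k D d = ∑ i ∈ s, i.1 ⊗ₜ[k] i.2) :
    PsiPhi φ (d ⊗ₜ c) =
      ∑ i ∈ s, i.1 ⊗ₜ[k] sliceLeft (φ ∘ₗ (TensorProduct.mk k C D).flip i.2) c := by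
  simp only [PsiPhi, sliceLeft, LinearMap.comp_apply, LinearEquiv.coe_coe, map_tmul, hs,
    sum_tmul, map_sum]
  refine Finset.sum_congr rfl fun i _ => ?_
  induction cmul k C c with
  | zero => simp
  | add a b ha hb => simp only [tmul_add, map_add, ha, hb]
  | tmul a b => simp

theorem LC1_PsiPhi (φ : C ⊗[k] D →ₗ[k] k) : LC1 (PsiPhi φ) := by
  refine TensorProduct.ext' fun d c => ?_
  obtain ⟨s, hs⟩ := exists_cmul_eq_sum (k := k) c
  simp only [LinearMap.comp_apply, LinearEquiv.coe_coe, rTensor_tmul,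
    PsiPhi_tmul_of_cmul_right φ d c s hs, map_sum, cmul_sliceRight]
  induction cmul k D d with
  | zero => simp
  | add a b ha hb => simp only [add_tmul, map_add, Finset.sum_add_distrib, ha, hb]
  | tmul a b => simp [PsiPhi_tmul_of_cmul_right φ b c s hs, tmul_sum]

theorem LC2_PsiPhi (φ : C ⊗[k] D →ₗ[k] k) : LC2 (PsiPhi φ) := by
  refine TensorProduct.ext' fun d c => ?_
  obtain ⟨s, hs⟩ := exists_cmul_eq_sum (k := k) d
  simp only [LinearMap.comp_apply, LinearEquiv.coe_coe, lTensor_tmul,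
    PsiPhi_tmul_of_cmul_left φ d c s hs, map_sum, cmul_sliceLeft]
  induction cmul k C c with
  | zero => simp
  | add a b ha hb => simp only [tmul_add, map_add, Finset.sum_add_distrib, ha, hb]
  | tmul a b => simp [PsiPhi_tmul_of_cmul_left φ d a s hs, sum_tmul]

theorem Ffun_tmul (Ψ' : D ⊗[k] C →ₗ[k] D ⊗[k] C) (c : C) (d : D) :
    Ffun Ψ' (c ⊗ₜ d) = TensorProduct.lid k k (map (eps k D) (eps k C) (Ψ' (d ⊗ₜ c))) := by
  simp [Ffun]

theorem Ffun_PsiPhi (φ : C ⊗[k] D →ₗ[k] k) : Ffun (PsiPhi φ) = φ := by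
  refine TensorProduct.ext' fun c d => ?_
  obtain ⟨s, hs⟩ := exists_cmul_eq_sum (k := k) c
  have hcounit : ∑ i ∈ s, eps k C i.2 • i.1 = c := by
    have h : lTensor C (eps k C) (cmul k C c) = c ⊗ₜ 1 := Coalgebra.lTensor_counit_comul c
    simpa [hs] using congrArg (TensorProduct.rid k C) h
  calc Ffun (PsiPhi φ) (c ⊗ₜ d) = φ ((∑ i ∈ s, eps k C i.2 • i.1) ⊗ₜ d) := by
        simp [Ffun_tmul, PsiPhi_tmul_of_cmul_right φ d c s hs, eps_sliceRight, sum_tmul,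
          ← smul_tmul', mul_comm]
    _ = φ (c ⊗ₜ d) := by rw [hcounit]

/-- By (LC2), contracting the `D`-output of `Ψ'` gives a left slice by `F(Ψ')`. -/
theorem LC2.lid_rTensor_eps {Ψ' : D ⊗[k] C →ₗ[k] D ⊗[k] C} (h : LC2 Ψ') (d : D) (c : C) :
    TensorProduct.lid k C (rTensor C (eps k D) (Ψ' (d ⊗ₜ c))) =
      sliceLeft (Ffun Ψ' ∘ₗ (TensorProduct.mk k C D).flip d) c := by
  have hc := LinearMap.congr_fun h (d ⊗ₜ c)
  simp only [LinearMap.comp_apply, LinearEquiv.coe_coe, lTensor_tmul] at hc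
  let contract : D ⊗[k] (C ⊗[k] C) →ₗ[k] C :=
    (TensorProduct.lid k C).toLinearMap ∘ₗ
      map (eps k D) ((TensorProduct.lid k C).toLinearMap ∘ₗ rTensor C (eps k C))
  have hleft : ∀ w : D ⊗[k] C, contract (lTensor D (cmul k C) w) =
      TensorProduct.lid k C (rTensor C (eps k D) w) := by
    intro w
    induction w with
    | zero => simp
    | add a b ha hb => simp only [map_add, ha, hb]
    | tmul x y =>
      have hy : rTensor C (eps k C) (cmul k C y) = 1 ⊗ₜ y := Coalgebra.rTensor_counit_comul y
      simp [contract, hy]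
  have hassoc : ∀ (w : D ⊗[k] C) (y : C), contract (TensorProduct.assoc k D C C (w ⊗ₜ y)) =
      TensorProduct.lid k k (map (eps k D) (eps k C) w) • y := by
    intro w y
    induction w with
    | zero => simp
    | add a b ha hb => simp only [add_tmul, map_add, add_smul, ha, hb]
    | tmul x z => simp [contract, smul_smul, mul_comm]
  rw [← hleft, hc]
  simp only [sliceLeft, LinearMap.comp_apply, LinearEquiv.coe_coe]
  induction cmul k C c with
  | zero => simp
  | add a b ha hb => simp only [tmul_add, map_add, ha, hb]
  | tmul a b => simp [hassoc, Ffun_tmul]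

theorem PsiPhi_Ffun {Ψ' : D ⊗[k] C →ₗ[k] D ⊗[k] C} (h₁ : LC1 Ψ') (h₂ : LC2 Ψ') :
    PsiPhi (Ffun Ψ') = Ψ' := by
  refine TensorProduct.ext' fun d c => ?_
  obtain ⟨s, hs⟩ := exists_cmul_eq_sum (k := k) d
  let contract : D ⊗[k] (D ⊗[k] C) →ₗ[k] D ⊗[k] C :=
    lTensor D ((TensorProduct.lid k C).toLinearMap ∘ₗ rTensor C (eps k D))
  have hd := congrArg contract (LinearMap.congr_fun h₁ (d ⊗ₜ c))
  have hright : ∀ w : D ⊗[k] C,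
      contract (TensorProduct.assoc k D D C (rTensor C (cmul k D) w)) = w := by
    intro w
    induction w with
    | zero => simp
    | add a b ha hb => simp only [map_add, ha, hb]
    | tmul x y =>
      have hx : lTensor D (eps k D) (cmul k D x) = x ⊗ₜ 1 := Coalgebra.lTensor_counit_comul x
      have hassoc : ∀ v : D ⊗[k] D, contract (TensorProduct.assoc k D D C (v ⊗ₜ y)) =
          TensorProduct.rid k D (lTensor D (eps k D) v) ⊗ₜ y := by
        intro v
        induction v with
        | zero => simp
        | add a b ha hb => simp only [add_tmul, map_add, ha, hb]
        | tmul a b => simp [contract, smul_tmul]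
      simp [hassoc, hx]
  simp only [LinearMap.comp_apply, LinearEquiv.coe_coe, hright] at hd
  rw [hd, PsiPhi_tmul_of_cmul_left _ d c s hs]
  simp [hs, sum_tmul, contract, h₂.lid_rTensor_eps]

theorem Ffun_comp_PsiPhi (Ψ' : D ⊗[k] C →ₗ[k] D ⊗[k] C) (φ : C ⊗[k] D →ₗ[k] k) :
    Ffun (Ψ' ∘ₗ PsiPhi φ) = starMul (Ffun Ψ') φ := by
  refine TensorProduct.ext' fun c d => ?_
  simp only [Ffun_tmul, starMul, PsiPhi, LinearMap.comp_apply, LinearEquiv.coe_coe, map_tmul]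
  induction cmul k D d with
  | zero => simp
  | add a b ha hb => simp only [tmul_add, add_tmul, map_add, ha, hb]
  | tmul x y =>
    induction cmul k C c with
    | zero => simp
    | add a b ha hb => simp only [tmul_add, add_tmul, map_add, ha, hb]
    | tmul u v => simp [Ffun_tmul, mul_comm]

theorem Ffun_id :
    Ffun (LinearMap.id : D ⊗[k] C →ₗ[k] D ⊗[k] C) = (tensorCounit : C ⊗[k] D →ₗ[k] k) :=
  TensorProduct.ext' fun c d => by simp [Ffun, tensorCounit, mul_comm]

theorem stmt13 :
    (∀ φ : C ⊗[k] D →ₗ[k] k, LC1 (PsiPhi φ) ∧ LC2 (PsiPhi φ)) ∧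
    (∀ φ : C ⊗[k] D →ₗ[k] k, Ffun (PsiPhi φ) = φ) ∧
    (∀ Ψ' : D ⊗[k] C →ₗ[k] D ⊗[k] C, LC1 Ψ' → LC2 Ψ' → PsiPhi (Ffun Ψ') = Ψ') ∧
    (∀ Ψ1 Ψ2 : D ⊗[k] C →ₗ[k] D ⊗[k] C, LC1 Ψ1 → LC2 Ψ1 → LC1 Ψ2 → LC2 Ψ2 →
      Ffun (Ψ2 ∘ₗ Ψ1) = starMul (Ffun Ψ2) (Ffun Ψ1)) ∧
    Ffun (LinearMap.id : D ⊗[k] C →ₗ[k] D ⊗[k] C) = (tensorCounit : C ⊗[k] D →ₗ[k] k) := by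
  refine ⟨fun φ => ⟨LC1_PsiPhi φ, LC2_PsiPhi φ⟩, Ffun_PsiPhi, fun _ => PsiPhi_Ffun, ?_, Ffun_id⟩
  intro Ψ1 Ψ2 h₁ h₂ _ _
  conv_lhs => rw [← PsiPhi_Ffun h₁ h₂]
  exact Ffun_comp_PsiPhi Ψ2 (Ffun Ψ1)

end TwistedTensor
end
end

section
/- Let Ψ : C⊗D → D⊗C be a twist map such that Ψ' := Ψ∘τ satisfies conditions (LC1) and (LC2), and set φ_Ψ := (ε_D⊗ε_C)∘Ψ : C⊗D → k. Then the twisted coproduct Δ_Ψ admits a counit if and only if φ_Ψ is invertible with respect to the convolution product ∗ on (C⊗D)', and in that case the convolution inverse φ_Ψ⁻¹ is a counit for Δ_Ψ. -/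
open TensorProduct LinearMap

noncomputable section
namespace TwistedTensor

variable {k : Type*} [Field k]
variable {C D : Type*} [AddCommGroup C] [Module k C] [AddCommGroup D] [Module k D]
  [Coalgebra k C] [Coalgebra k D]

/-- The left contraction of `A` by a functional, `a ↦ φ(a₁) a₂`. -/
def contractLeft {A : Type*} [AddCommGroup A] [Module k A] [Coalgebra k A] (φ : A →ₗ[k] k) :
    A →ₗ[k] A :=
  (TensorProduct.lid k A).toLinearMap ∘ₗ rTensor A φ ∘ₗ Coalgebra.comul

lemma convMul_eq (φ ψ : C ⊗[k] D →ₗ[k] k) :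
    convMul φ ψ = (TensorProduct.lid k k).toLinearMap ∘ₗ map φ ψ ∘ₗ Coalgebra.comul := rfl

lemma tensorCounit_eq : (tensorCounit : C ⊗[k] D →ₗ[k] k) = Coalgebra.counit := by
  ext
  simp [tensorCounit, eps, TensorProduct.counit_tmul, mul_comm]

section Coalgebra

variable {A : Type*} [AddCommGroup A] [Module k A] [Coalgebra k A]

lemma contractLeft_counit : contractLeft (Coalgebra.counit : A →ₗ[k] k) = LinearMap.id := by
  ext a
  simp [contractLeft]

lemma rid_lTensor_counit_comul :
    (TensorProduct.rid k A).toLinearMap ∘ₗ lTensor A Coalgebra.counit ∘ₗ Coalgebra.comul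
      = LinearMap.id := by
  ext a
  simp

lemma counit_comp_contractLeft (φ : A →ₗ[k] k) :
    Coalgebra.counit ∘ₗ contractLeft φ = φ := by
  have h : Coalgebra.counit ∘ₗ (TensorProduct.lid k A).toLinearMap ∘ₗ rTensor A φ
      = φ ∘ₗ (TensorProduct.rid k A).toLinearMap ∘ₗ lTensor A Coalgebra.counit := by
    ext x y
    simp [mul_comm]
  calc _ = (Coalgebra.counit ∘ₗ (TensorProduct.lid k A).toLinearMap ∘ₗ rTensor A φ)
        ∘ₗ Coalgebra.comul := rfl
    _ = φ ∘ₗ ((TensorProduct.rid k A).toLinearMap ∘ₗ lTensor A Coalgebra.counit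
        ∘ₗ Coalgebra.comul) := by rw [h]; rfl
    _ = φ := by rw [rid_lTensor_counit_comul]; rfl

lemma counit_comp_rid_lTensor_comul (φ : A →ₗ[k] k) :
    Coalgebra.counit ∘ₗ (TensorProduct.rid k A).toLinearMap ∘ₗ lTensor A φ ∘ₗ Coalgebra.comul
      = φ := by
  have h : Coalgebra.counit ∘ₗ (TensorProduct.rid k A).toLinearMap ∘ₗ lTensor A φ
      = φ ∘ₗ (TensorProduct.lid k A).toLinearMap ∘ₗ rTensor A Coalgebra.counit := by
    ext x y
    simp [mul_comm]
  calc _ = (Coalgebra.counit ∘ₗ (TensorProduct.rid k A).toLinearMap ∘ₗ lTensor A φ)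
        ∘ₗ Coalgebra.comul := rfl
    _ = φ ∘ₗ contractLeft Coalgebra.counit := by rw [h]; rfl
    _ = φ := by rw [contractLeft_counit]; rfl

lemma rTensor_contractLeft (e φ : A →ₗ[k] k) :
    (TensorProduct.lid k A).toLinearMap ∘ₗ rTensor A e ∘ₗ lTensor A (contractLeft φ)
        ∘ₗ Coalgebra.comul
      = contractLeft ((TensorProduct.lid k k).toLinearMap ∘ₗ map e φ ∘ₗ Coalgebra.comul) := by
  have h : (TensorProduct.lid k A).toLinearMap ∘ₗ rTensor A e
        ∘ₗ lTensor A ((TensorProduct.lid k A).toLinearMap ∘ₗ rTensor A φ)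
        ∘ₗ (TensorProduct.assoc k A A A).toLinearMap
      = (TensorProduct.lid k A).toLinearMap
        ∘ₗ rTensor A ((TensorProduct.lid k k).toLinearMap ∘ₗ map e φ) := by
    ext x y z
    simpa [mul_smul] using smul_comm (φ y) (e x) z
  ext a
  have := LinearMap.congr_fun h (rTensor A Coalgebra.comul (Coalgebra.comul a))
  simp only [coe_comp, Function.comp_apply, LinearEquiv.coe_coe, Coalgebra.coassoc_apply] at this
  simpa [contractLeft, lTensor_comp, rTensor_comp] using this

lemma lTensor_contractLeft (e φ : A →ₗ[k] k) :
    lTensor A e ∘ₗ lTensor A (contractLeft φ)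
      = lTensor A ((TensorProduct.lid k k).toLinearMap ∘ₗ map φ e ∘ₗ Coalgebra.comul) := by
  rw [← lTensor_comp]
  congr 1
  have h : e ∘ₗ (TensorProduct.lid k A).toLinearMap ∘ₗ rTensor A φ
      = (TensorProduct.lid k k).toLinearMap ∘ₗ map φ e := by
    ext x y
    simp
  simp only [contractLeft, ← LinearMap.comp_assoc] at h ⊢
  rw [h]

end Coalgebra

/-- A map satisfying (LC1) is determined by its composite with `ε_D ⊗ id_E`. -/
lemma LC1.eq_lTensor {E : Type*} [AddCommGroup E] [Module k E]
    {P : D ⊗[k] E →ₗ[k] D ⊗[k] E} (h : LC1 P) :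
    P = lTensor D ((TensorProduct.lid k E).toLinearMap ∘ₗ rTensor E (eps k D) ∘ₗ P)
      ∘ₗ (TensorProduct.assoc k D D E).toLinearMap ∘ₗ rTensor E (cmul k D) := by
  have hid : lTensor D ((TensorProduct.lid k E).toLinearMap ∘ₗ rTensor E (eps k D))
      ∘ₗ (TensorProduct.assoc k D D E).toLinearMap ∘ₗ rTensor E (cmul k D) = LinearMap.id := by
    have hr : lTensor D ((TensorProduct.lid k E).toLinearMap ∘ₗ rTensor E (eps k D))
        ∘ₗ (TensorProduct.assoc k D D E).toLinearMap
        = rTensor E ((TensorProduct.rid k D).toLinearMap ∘ₗ lTensor D (eps k D)) := by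
      ext x y z
      simp [TensorProduct.smul_tmul]
    rw [← LinearMap.comp_assoc, hr, ← rTensor_comp, LinearMap.comp_assoc]
    have : (TensorProduct.rid k D).toLinearMap ∘ₗ lTensor D (eps k D) ∘ₗ cmul k D
      = LinearMap.id := rid_lTensor_counit_comul
    rw [this, rTensor_id]
  have key := congrArg
    (lTensor D ((TensorProduct.lid k E).toLinearMap ∘ₗ rTensor E (eps k D)) ∘ₗ ·) h
  simp only [← LinearMap.comp_assoc, ← lTensor_comp] at key hid ⊢
  rw [hid, LinearMap.id_comp] at key
  exact key

/-- For a map `P` satisfying (LC2), `(ε_D ⊗ id_C) ∘ P` is determined by `(ε_D ⊗ ε_C) ∘ P`. -/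
lemma LC2.lid_rTensor_eps_s14 {P : D ⊗[k] C →ₗ[k] D ⊗[k] C} (h : LC2 P) :
    (TensorProduct.lid k C).toLinearMap ∘ₗ rTensor C (eps k D) ∘ₗ P
      = (TensorProduct.lid k C).toLinearMap
        ∘ₗ rTensor C ((TensorProduct.lid k k).toLinearMap ∘ₗ map (eps k D) (eps k C) ∘ₗ P)
        ∘ₗ (TensorProduct.assoc k D C C).symm.toLinearMap ∘ₗ lTensor D (cmul k C) := by
  have hc : (TensorProduct.lid k C).toLinearMap ∘ₗ rTensor C (eps k D)
      ∘ₗ lTensor D (contractLeft (eps k C))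
      = (TensorProduct.lid k C).toLinearMap ∘ₗ rTensor C (eps k D) := by
    have : contractLeft (eps k C) = LinearMap.id := contractLeft_counit
    rw [this, lTensor_id, LinearMap.comp_id]
  have hr : (TensorProduct.lid k C).toLinearMap ∘ₗ rTensor C (eps k D)
      ∘ₗ lTensor D ((TensorProduct.lid k C).toLinearMap ∘ₗ rTensor C (eps k C))
      ∘ₗ (TensorProduct.assoc k D C C).toLinearMap
      = (TensorProduct.lid k C).toLinearMap
        ∘ₗ rTensor C ((TensorProduct.lid k k).toLinearMap ∘ₗ map (eps k D) (eps k C)) := by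
    ext x y z
    simpa [mul_smul] using smul_comm (eps k C y) (eps k D x) z
  have key := congrArg
    (((TensorProduct.lid k C).toLinearMap ∘ₗ rTensor C (eps k D)
      ∘ₗ lTensor D ((TensorProduct.lid k C).toLinearMap ∘ₗ rTensor C (eps k C))) ∘ₗ ·) h
  change _ ∘ₗ _ = ((TensorProduct.lid k C).toLinearMap ∘ₗ rTensor C (eps k D)
      ∘ₗ lTensor D ((TensorProduct.lid k C).toLinearMap ∘ₗ rTensor C (eps k C))
      ∘ₗ (TensorProduct.assoc k D C C).toLinearMap) ∘ₗ _ at key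
  rw [hr] at key
  have hl : contractLeft (eps k C)
    = ((TensorProduct.lid k C).toLinearMap ∘ₗ rTensor C (eps k C)) ∘ₗ cmul k C := rfl
  rw [hl, lTensor_comp] at hc
  simp only [← LinearMap.comp_assoc, rTensor_comp] at key hc ⊢
  rw [hc] at key
  exact key

/-- `c ⊗ (c' ⊗ c'') ⊗ (d ⊗ (d' ⊗ d'')) ↦ φ(c' ⊗ d') (c ⊗ d) ⊗ (c'' ⊗ d'')`. -/
def contractMid (φ : C ⊗[k] D →ₗ[k] k) :
    (C ⊗[k] (C ⊗[k] C)) ⊗[k] (D ⊗[k] (D ⊗[k] D)) →ₗ[k] (C ⊗[k] D) ⊗[k] (C ⊗[k] D) :=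
  lTensor (C ⊗[k] D) ((TensorProduct.lid k (C ⊗[k] D)).toLinearMap ∘ₗ rTensor (C ⊗[k] D) φ
      ∘ₗ (tensorTensorTensorComm k C C D D).toLinearMap)
    ∘ₗ (tensorTensorTensorComm k C (C ⊗[k] C) D (D ⊗[k] D)).toLinearMap

lemma lTensor_contractLeft_comul (φ : C ⊗[k] D →ₗ[k] k) :
    lTensor (C ⊗[k] D) (contractLeft φ) ∘ₗ Coalgebra.comul
      = contractMid φ ∘ₗ map (lTensor C (cmul k C) ∘ₗ cmul k C)
          (lTensor D (cmul k D) ∘ₗ cmul k D) := by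
  have h : lTensor (C ⊗[k] D) (contractLeft φ)
        ∘ₗ (tensorTensorTensorComm k C C D D).toLinearMap
      = contractMid φ ∘ₗ map (lTensor C (cmul k C)) (lTensor D (cmul k D)) := by
    ext x y u v
    simp only [contractMid, contractLeft, cmul, TensorProduct.comul_def]
    simp
    rfl
  rw [map_comp, ← LinearMap.comp_assoc, ← h]
  rfl

lemma twist_tmul {Ψ : C ⊗[k] D →ₗ[k] D ⊗[k] C}
    (h1 : LC1 (psiPrime Ψ)) (h2 : LC2 (psiPrime Ψ)) (c : C) (d : D) :
    Ψ (c ⊗ₜ d) = lTensor D ((TensorProduct.lid k C).toLinearMap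
        ∘ₗ rTensor C (epsZ Ψ ∘ₗ (TensorProduct.comm k D C).toLinearMap)
        ∘ₗ (TensorProduct.assoc k D C C).symm.toLinearMap)
      (TensorProduct.assoc k D D (C ⊗[k] C) (cmul k D d ⊗ₜ cmul k C c)) := by
  have h := h1.eq_lTensor
  rw [h2.lid_rTensor_eps_s14] at h
  have key := LinearMap.congr_fun h (d ⊗ₜ c)
  have e : psiPrime Ψ (d ⊗ₜ c) = Ψ (c ⊗ₜ d) := by simp [psiPrime]
  rw [e] at key
  rw [key]
  simp only [coe_comp, Function.comp_apply, rTensor_tmul, LinearEquiv.coe_coe]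
  generalize cmul k D d = s
  induction s with
  | zero => simp
  | add x y hx hy => simp only [TensorProduct.add_tmul, map_add, hx, hy]
  | tmul x y => simp; rfl

lemma twistedComul_eq {Ψ : C ⊗[k] D →ₗ[k] D ⊗[k] C}
    (h1 : LC1 (psiPrime Ψ)) (h2 : LC2 (psiPrime Ψ)) :
    twistedComul Ψ = lTensor (C ⊗[k] D) (contractLeft (epsZ Ψ)) ∘ₗ Coalgebra.comul := by
  have hd : lTensor D (cmul k D) ∘ₗ cmul k D
      = ((TensorProduct.assoc k D D D).toLinearMap ∘ₗ rTensor D (cmul k D)) ∘ₗ cmul k D :=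
    Coalgebra.coassoc.symm
  rw [lTensor_contractLeft_comul, hd, map_comp, ← LinearMap.comp_assoc]
  simp only [twistedComul, ← LinearMap.comp_assoc]
  congr 1
  ext x y u v
  simp only [TensorProduct.AlgebraTensorModule.curry_apply, TensorProduct.curry_apply,
    LinearMap.restrictScalars_self, coe_comp, Function.comp_apply, LinearEquiv.coe_coe,
    TensorProduct.assoc_tmul, TensorProduct.assoc_symm_tmul, lTensor_tmul, rTensor_tmul,
    map_tmul, twist_tmul h1 h2]
  generalize cmul k C y = s
  generalize cmul k D u = t
  induction s with
  | zero => simp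
  | add a b ha hb =>
    simp only [TensorProduct.add_tmul, TensorProduct.tmul_add, map_add, ha, hb]
  | tmul a b =>
    induction t with
    | zero => simp
    | add p q hp hq =>
      simp only [TensorProduct.add_tmul, TensorProduct.tmul_add, map_add, hp, hq]
    | tmul p q =>
      simp only [contractMid, coe_comp, Function.comp_apply, LinearEquiv.coe_coe, lTensor_tmul,
        rTensor_tmul, comm_tmul, assoc_tmul, assoc_symm_tmul, lid_tmul,
        tensorTensorTensorComm_tmul, ← smul_tmul', tmul_smul, map_smul]

/-- Counits of the twisted coproduct are exactly the convolution inverses of `epsZ Ψ`. -/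
lemma isCounit_twistedComul_iff {Ψ : C ⊗[k] D →ₗ[k] D ⊗[k] C}
    (h1 : LC1 (psiPrime Ψ)) (h2 : LC2 (psiPrime Ψ)) (e : C ⊗[k] D →ₗ[k] k) :
    IsCounit (twistedComul Ψ) e ↔
      convMul (epsZ Ψ) e = tensorCounit ∧ convMul e (epsZ Ψ) = tensorCounit := by
  have hl : (TensorProduct.lid k (C ⊗[k] D)).toLinearMap ∘ₗ rTensor (C ⊗[k] D) e
      ∘ₗ twistedComul Ψ = contractLeft (convMul e (epsZ Ψ)) := by
    rw [twistedComul_eq h1 h2, rTensor_contractLeft, convMul_eq]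
  have hr : (TensorProduct.rid k (C ⊗[k] D)).toLinearMap ∘ₗ lTensor (C ⊗[k] D) e
      ∘ₗ twistedComul Ψ = (TensorProduct.rid k (C ⊗[k] D)).toLinearMap
        ∘ₗ lTensor (C ⊗[k] D) (convMul (epsZ Ψ) e) ∘ₗ Coalgebra.comul := by
    rw [twistedComul_eq h1 h2, ← LinearMap.comp_assoc Coalgebra.comul, lTensor_contractLeft,
      convMul_eq]
  rw [IsCounit, hl, hr, tensorCounit_eq]
  constructor
  · rintro ⟨hl, hr⟩
    constructor
    · rw [← counit_comp_rid_lTensor_comul (convMul (epsZ Ψ) e), hr, LinearMap.comp_id]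
    · rw [← counit_comp_contractLeft (convMul e (epsZ Ψ)), hl, LinearMap.comp_id]
  · rintro ⟨hr, hl⟩
    rw [hl, hr]
    exact ⟨contractLeft_counit, rid_lTensor_counit_comul⟩

theorem stmt14 (Ψ : C ⊗[k] D →ₗ[k] D ⊗[k] C)
    (h1 : LC1 (psiPrime Ψ)) (h2 : LC2 (psiPrime Ψ)) :
    ((∃ e : C ⊗[k] D →ₗ[k] k, IsCounit (twistedComul Ψ) e) ↔
      (∃ φi : C ⊗[k] D →ₗ[k] k,
        convMul (epsZ Ψ) φi = tensorCounit ∧ convMul φi (epsZ Ψ) = tensorCounit)) ∧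
    (∀ φi : C ⊗[k] D →ₗ[k] k,
      convMul (epsZ Ψ) φi = tensorCounit → convMul φi (epsZ Ψ) = tensorCounit →
      IsCounit (twistedComul Ψ) φi) := by
  exact ⟨exists_congr (isCounit_twistedComul_iff h1 h2),
    fun φi h h' => (isCounit_twistedComul_iff h1 h2 φi).2 ⟨h, h'⟩⟩

end TwistedTensor
end
end
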